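/- arXiv:1012.4228 — 10 statements merged into one kernel-verified Lean document; each statement's English description precedes it below -/
import Mathlib

section
/- For every real number a with 0 < a < 1, there exists exactly one continuous function F : [0,1] → ℝ satisfying, for all x ∈ [0,1]: F(x/3) = a·F(x), F((2−x)/3) = (2a−1)·F(x) + (1−a), and F((2+x)/3) = a·F(x) + (1−a). -/
open Set MeasureTheory Filter

/-- `F : ℝ → ℝ` (regarded as a function on `[0,1]`) is an Okamoto function with
parameter `a` if it is continuous on `[0,1]` and satisfies the three self-affine
functional equations for all `x ∈ [0,1]`. -/
def IsOkamoto (a : ℝ) (F : ℝ → ℝ) : Prop :=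
  ContinuousOn F (Set.Icc 0 1) ∧
  ∀ x ∈ Set.Icc (0 : ℝ) 1,
    F (x / 3) = a * F x ∧
    F ((2 - x) / 3) = (2 * a - 1) * F x + (1 - a) ∧
    F ((2 + x) / 3) = a * F x + (1 - a)

open scoped unitInterval

/-- The continuous functions on the unit interval with `f 0 = 0` and `f 1 = 1`. -/
def normalizedMaps : Set C(I, ℝ) := {f | f 0 = 0 ∧ f 1 = 1}

lemma isClosed_normalizedMaps : IsClosed normalizedMaps :=
  (isClosed_eq (continuous_eval_const 0) continuous_const).inter
    (isClosed_eq (continuous_eval_const 1) continuous_const)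

/-- The self-affine operator whose fixed points among the normalized maps are the
Okamoto functions. Clamping the arguments to `[0,1]` makes the three branches
constant outside the third of the interval they describe. -/
noncomputable def okamotoOperator (a : ℝ) (f : C(I, ℝ)) : C(I, ℝ) where
  toFun x := a * f (projIcc 0 1 zero_le_one (3 * x)) +
    (1 - 2 * a) * (1 - f (projIcc 0 1 zero_le_one (2 - 3 * x))) +
    a * f (projIcc 0 1 zero_le_one (3 * x - 2))
  continuous_toFun := by
    have := continuous_projIcc (a := (0 : ℝ)) (b := 1) (h := zero_le_one)
    fun_prop

lemma projIcc_eq_of_eq {t : ℝ} (y : I) (h : t = y) :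
    projIcc (0 : ℝ) 1 zero_le_one t = y := by
  rw [h, projIcc_val]

section Branches

variable {a : ℝ} {f : C(I, ℝ)} {x y : I}

lemma okamotoOperator_left (hf : f ∈ normalizedMaps) (h : (x : ℝ) = y / 3) :
    okamotoOperator a f x = a * f y := by
  have hy := y.2
  have h₁ := projIcc_eq_of_eq (t := 3 * x) y (by linarith)
  have h₂ : projIcc (0 : ℝ) 1 zero_le_one (2 - 3 * x) = 1 :=
    projIcc_of_right_le _ (by linarith [hy.2])
  have h₃ : projIcc (0 : ℝ) 1 zero_le_one (3 * x - 2) = 0 :=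
    projIcc_of_le_left _ (by linarith [hy.2])
  simp only [okamotoOperator, ContinuousMap.coe_mk, h₁, h₂, h₃, hf.1, hf.2]
  ring

lemma okamotoOperator_middle (hf : f ∈ normalizedMaps) (h : (x : ℝ) = (2 - y) / 3) :
    okamotoOperator a f x = (2 * a - 1) * f y + (1 - a) := by
  have hy := y.2
  have h₁ : projIcc (0 : ℝ) 1 zero_le_one (3 * x) = 1 :=
    projIcc_of_right_le _ (by linarith [hy.2])
  have h₂ := projIcc_eq_of_eq (t := 2 - 3 * x) y (by linarith)
  have h₃ : projIcc (0 : ℝ) 1 zero_le_one (3 * x - 2) = 0 :=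
    projIcc_of_le_left _ (by linarith [hy.1])
  simp only [okamotoOperator, ContinuousMap.coe_mk, h₁, h₂, h₃, hf.1, hf.2]
  ring

lemma okamotoOperator_right (hf : f ∈ normalizedMaps) (h : (x : ℝ) = (2 + y) / 3) :
    okamotoOperator a f x = a * f y + (1 - a) := by
  have hy := y.2
  have h₁ : projIcc (0 : ℝ) 1 zero_le_one (3 * x) = 1 :=
    projIcc_of_right_le _ (by linarith [hy.1])
  have h₂ : projIcc (0 : ℝ) 1 zero_le_one (2 - 3 * x) = 0 :=
    projIcc_of_le_left _ (by linarith [hy.1])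
  have h₃ := projIcc_eq_of_eq (t := 3 * x - 2) y (by linarith)
  simp only [okamotoOperator, ContinuousMap.coe_mk, h₁, h₂, h₃, hf.1, hf.2]
  ring

end Branches

lemma exists_eq_third_branch (x : I) :
    ∃ y : I, (x : ℝ) = y / 3 ∨ (x : ℝ) = (2 - y) / 3 ∨ (x : ℝ) = (2 + y) / 3 := by
  have hx := x.2
  rcases le_total (x : ℝ) (1 / 3) with h | h
  · exact ⟨⟨3 * x, by linarith [hx.1], by linarith⟩, Or.inl (by simp)⟩
  rcases le_total (x : ℝ) (2 / 3) with h' | h'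
  · exact ⟨⟨2 - 3 * x, by linarith, by linarith⟩, Or.inr (Or.inl (by simp))⟩
  · exact ⟨⟨3 * x - 2, by linarith, by linarith [hx.2]⟩, Or.inr (Or.inr (by simp))⟩

lemma okamotoOperator_mem (a : ℝ) {f : C(I, ℝ)} (hf : f ∈ normalizedMaps) :
    okamotoOperator a f ∈ normalizedMaps := by
  constructor
  · rw [okamotoOperator_left (y := 0) hf (by simp), hf.1, mul_zero]
  · rw [okamotoOperator_right (y := 1) hf (by norm_num), hf.2]
    ring

lemma dist_okamotoOperator_le (a : ℝ) {f g : C(I, ℝ)} (hf : f ∈ normalizedMaps)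
    (hg : g ∈ normalizedMaps) :
    dist (okamotoOperator a f) (okamotoOperator a g) ≤ max |a| |2 * a - 1| * dist f g := by
  rw [ContinuousMap.dist_le (by positivity)]
  intro x
  have key (c d : ℝ) (hc : |c| ≤ max |a| |2 * a - 1|) (y : I) :
      dist (c * f y + d) (c * g y + d) ≤ max |a| |2 * a - 1| * dist f g := by
    rw [dist_add_right, Real.dist_eq, ← mul_sub, abs_mul, ← Real.dist_eq]
    exact mul_le_mul hc (ContinuousMap.dist_apply_le_dist y) dist_nonneg (by positivity)
  obtain ⟨y, h | h | h⟩ := exists_eq_third_branch x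
  · rw [okamotoOperator_left hf h, okamotoOperator_left hg h]
    simpa using key a 0 (le_max_left _ _) y
  · rw [okamotoOperator_middle hf h, okamotoOperator_middle hg h]
    exact key _ _ (le_max_right _ _) y
  · rw [okamotoOperator_right hf h, okamotoOperator_right hg h]
    exact key _ _ (le_max_left _ _) y

/-- The operator has exactly one fixed point among the normalized maps. -/
lemma existsUnique_okamotoOperator_eq {a : ℝ} (ha : a ∈ Set.Ioo (0 : ℝ) 1) :
    ∃! f : C(I, ℝ), f ∈ normalizedMaps ∧ okamotoOperator a f = f := by
  let T : normalizedMaps → normalizedMaps :=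
    fun f => ⟨okamotoOperator a f, okamotoOperator_mem a f.2⟩
  have : CompleteSpace normalizedMaps := isClosed_normalizedMaps.completeSpace_coe
  have : Nonempty normalizedMaps := ⟨⟨⟨Subtype.val, continuous_subtype_val⟩, rfl, rfl⟩⟩
  have hk : max |a| |2 * a - 1| < 1 :=
    max_lt (abs_lt.2 ⟨by linarith [ha.1], ha.2⟩)
      (abs_lt.2 ⟨by linarith [ha.1], by linarith [ha.2]⟩)
  have hT : ContractingWith ⟨max |a| |2 * a - 1|, by positivity⟩ T :=
    ⟨by exact_mod_cast hk,
      LipschitzWith.of_dist_le_mul fun f g => dist_okamotoOperator_le a f.2 g.2⟩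
  refine ⟨hT.fixedPoint, ⟨hT.fixedPoint.2, congrArg Subtype.val hT.fixedPoint_isFixedPt⟩, ?_⟩
  rintro g ⟨hg, hfix⟩
  exact congrArg Subtype.val (hT.fixedPoint_unique (x := ⟨g, hg⟩) (Subtype.ext hfix))

lemma isOkamoto_IccExtend {a : ℝ} {f : C(I, ℝ)} (hf : f ∈ normalizedMaps)
    (hfix : okamotoOperator a f = f) : IsOkamoto a (IccExtend zero_le_one f) := by
  refine ⟨f.continuous.Icc_extend'.continuousOn, fun x hx => ?_⟩
  have h₁ : x / 3 ∈ Icc (0 : ℝ) 1 := ⟨by linarith [hx.1], by linarith [hx.2]⟩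
  have h₂ : (2 - x) / 3 ∈ Icc (0 : ℝ) 1 := ⟨by linarith [hx.2], by linarith [hx.1]⟩
  have h₃ : (2 + x) / 3 ∈ Icc (0 : ℝ) 1 := ⟨by linarith [hx.1], by linarith [hx.2]⟩
  rw [IccExtend_of_mem _ _ hx, IccExtend_of_mem _ _ h₁, IccExtend_of_mem _ _ h₂,
    IccExtend_of_mem _ _ h₃]
  refine ⟨?_, ?_, ?_⟩
  · conv_lhs => rw [← hfix]
    exact okamotoOperator_left hf rfl
  · conv_lhs => rw [← hfix]
    exact okamotoOperator_middle hf rfl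
  · conv_lhs => rw [← hfix]
    exact okamotoOperator_right hf rfl

lemma IsOkamoto.restrict_mem_and_fixed {a : ℝ} {G : ℝ → ℝ} (hG : IsOkamoto a G)
    (ha : a ≠ 1) :
    (⟨_, hG.1.domRestrict⟩ : C(I, ℝ)) ∈ normalizedMaps ∧
      okamotoOperator a ⟨_, hG.1.domRestrict⟩ = ⟨_, hG.1.domRestrict⟩ := by
  have ha' : 1 - a ≠ 0 := sub_ne_zero.2 ha.symm
  have hmem : (⟨_, hG.1.domRestrict⟩ : C(I, ℝ)) ∈ normalizedMaps := by
    constructor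
    · have h := (hG.2 0 (by simp)).1
      rw [zero_div] at h
      exact mul_left_cancel₀ ha' (show (1 - a) * G 0 = (1 - a) * 0 by linarith)
    · have h := (hG.2 1 (by simp)).2.2
      rw [show ((2 : ℝ) + 1) / 3 = 1 by norm_num] at h
      exact mul_left_cancel₀ ha' (show (1 - a) * G 1 = (1 - a) * 1 by linarith)
  refine ⟨hmem, ContinuousMap.ext fun x => ?_⟩
  obtain ⟨y, h | h | h⟩ := exists_eq_third_branch x
  · rw [okamotoOperator_left hmem h]
    simpa [h] using (hG.2 y y.2).1.symm
  · rw [okamotoOperator_middle hmem h]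
    simpa [h] using (hG.2 y y.2).2.1.symm
  · rw [okamotoOperator_right hmem h]
    simpa [h] using (hG.2 y y.2).2.2.symm

/-- For every `a ∈ (0,1)` there is exactly one continuous function on `[0,1]`
satisfying the Okamoto functional equations. -/
theorem okamoto_existsUnique (a : ℝ) (ha : a ∈ Set.Ioo (0 : ℝ) 1) :
    ∃ F : ℝ → ℝ, IsOkamoto a F ∧
      ∀ G : ℝ → ℝ, IsOkamoto a G → Set.EqOn G F (Set.Icc 0 1) := by
  obtain ⟨f, ⟨hf, hfix⟩, huniq⟩ := existsUnique_okamotoOperator_eq ha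
  refine ⟨IccExtend zero_le_one f, isOkamoto_IccExtend hf hfix, fun G hG x hx => ?_⟩
  rw [IccExtend_of_mem _ _ hx, ← huniq _ (hG.restrict_mem_and_fixed ha.2.ne)]
  rfl
end

section
/- Let a₀ ∈ (1/2, 2/3) satisfy 27a₀² − 54a₀³ = −1, and let F be an Okamoto function with parameter a₀. Then the set of points x ∈ [0,1] at which F is differentiable within [0,1] has Lebesgue measure 0; equivalently, the set S of points where F is not differentiable within [0,1] has Lebesgue measure 1. -/
open Set MeasureTheory Filter

/-- The `k`-th triadic interval of generation `n`. -/
def triadicCell (n k : ℕ) : Set ℝ := Ico (k / 3 ^ n : ℝ) ((k + 1) / 3 ^ n)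

lemma mem_triadicCell_iff {n k : ℕ} {x : ℝ} :
    x ∈ triadicCell n k ↔ 0 ≤ x ∧ ⌊3 ^ n * x⌋₊ = k := by
  have h3 : (0 : ℝ) < 3 ^ n := by positivity
  rw [triadicCell, mem_Ico, div_le_iff₀ h3, lt_div_iff₀ h3, mul_comm x]
  constructor
  · rintro ⟨h1, h2⟩
    have h0 : 0 ≤ 3 ^ n * x := (Nat.cast_nonneg k).trans h1
    exact ⟨nonneg_of_mul_nonneg_right h0 h3, (Nat.floor_eq_iff h0).2 ⟨h1, h2⟩⟩
  · rintro ⟨h1, h2⟩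
    exact (Nat.floor_eq_iff (by positivity)).1 h2

lemma measurableSet_triadicCell (n k : ℕ) : MeasurableSet (triadicCell n k) :=
  measurableSet_Ico

lemma volume_real_triadicCell (n k : ℕ) : volume.real (triadicCell n k) = 1 / 3 ^ n := by
  rw [triadicCell, Real.volume_real_Ico_of_le (by gcongr; linarith)]
  ring

lemma disjoint_triadicCell (n : ℕ) {k l : ℕ} (h : k ≠ l) :
    Disjoint (triadicCell n k) (triadicCell n l) := by
  rw [Set.disjoint_left]
  intro x hk hl
  exact h ((mem_triadicCell_iff.1 hk).2.symm.trans (mem_triadicCell_iff.1 hl).2)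

lemma floor_three_pow_succ_div (n : ℕ) (x : ℝ) : ⌊3 ^ (n + 1) * x⌋₊ / 3 = ⌊3 ^ n * x⌋₊ := by
  rw [← Nat.floor_div_ofNat]
  congr 1
  ring

lemma triadicCell_eq_biUnion (n k : ℕ) :
    triadicCell n k = ⋃ j ∈ Finset.range 3, triadicCell (n + 1) (3 * k + j) := by
  ext x
  simp only [mem_iUnion, mem_triadicCell_iff, Finset.mem_range, exists_prop]
  have := floor_three_pow_succ_div n x
  constructor
  · rintro ⟨hx, h⟩
    exact ⟨⌊3 ^ (n + 1) * x⌋₊ % 3, Nat.mod_lt _ (by norm_num), hx, by omega⟩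
  · rintro ⟨j, hj, hx, h⟩
    exact ⟨hx, by omega⟩

lemma floor_three_pow_lt {x : ℝ} (hx : x ∈ Ico (0 : ℝ) 1) (n : ℕ) : ⌊3 ^ n * x⌋₊ < 3 ^ n := by
  rw [Nat.floor_lt (mul_nonneg (by positivity) hx.1)]
  push_cast
  exact mul_lt_of_lt_one_right (by positivity) hx.2

/-- The weight of the `n`-th ternary digit of `x`. -/
noncomputable def digitWeight (w : ℕ → ℝ) (n : ℕ) (x : ℝ) : ℝ := w (⌊3 ^ (n + 1) * x⌋₊ % 3)

/-- The sum of the weights of the first `n` ternary digits of `x`. -/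
noncomputable def digitWalk (w : ℕ → ℝ) (n : ℕ) (x : ℝ) : ℝ :=
  ∑ i ∈ Finset.range n, digitWeight w i x

/-- The filtration of `ℝ` generated by the triadic intervals. -/
noncomputable def triadicFiltration : Filtration ℕ (inferInstance : MeasurableSpace ℝ) where
  seq n := MeasurableSpace.comap (fun x : ℝ => ⌊3 ^ n * x⌋₊) ⊤
  mono' := by
    refine monotone_nat_of_le_succ fun n => ?_
    rintro _ ⟨B, -, rfl⟩
    refine ⟨(fun m => m / 3) ⁻¹' B, trivial, ?_⟩
    ext x
    simp [floor_three_pow_succ_div]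
  le' n := by
    rintro _ ⟨B, -, rfl⟩
    exact (Nat.measurable_floor.comp (measurable_const_mul (3 ^ n : ℝ))) (by measurability)

lemma measurable_digitWeight (w : ℕ → ℝ) (n : ℕ) :
    Measurable[triadicFiltration (n + 1)] (digitWeight w n) := by
  rintro s -
  exact ⟨(fun m => w (m % 3)) ⁻¹' s, trivial, rfl⟩

lemma stronglyAdapted_digitWalk (w : ℕ → ℝ) :
    StronglyAdapted triadicFiltration (digitWalk w) := by
  intro n
  refine Measurable.stronglyMeasurable ?_
  refine Finset.measurable_sum _ fun i hi => ?_
  exact (measurable_digitWeight w i).mono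
    (triadicFiltration.mono (Nat.succ_le_of_lt (Finset.mem_range.1 hi))) le_rfl

lemma abs_digitWeight_le (w : ℕ → ℝ) (n : ℕ) (x : ℝ) :
    |digitWeight w n x| ≤ ∑ j ∈ Finset.range 3, |w j| :=
  Finset.single_le_sum (f := fun j => |w j|) (fun _ _ => abs_nonneg _)
    (Finset.mem_range.2 (Nat.mod_lt _ (by norm_num)))

lemma integrable_digitWeight (w : ℕ → ℝ) (n : ℕ) (μ : Measure ℝ) [IsFiniteMeasure μ] :
    Integrable (digitWeight w n) μ := by
  refine Integrable.of_bound (C := ∑ j ∈ Finset.range 3, |w j|) ?_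
    (ae_of_all _ (abs_digitWeight_le w n))
  exact ((measurable_digitWeight w n).mono (triadicFiltration.le _) le_rfl).aestronglyMeasurable

lemma integrableOn_digitWeight_triadicCell (w : ℕ → ℝ) (i n k : ℕ) :
    IntegrableOn (digitWeight w i) (triadicCell n k) :=
  haveI : IsFiniteMeasure (volume.restrict (triadicCell n k)) :=
    ⟨by simp [triadicCell]⟩
  integrable_digitWeight w i _

lemma setIntegral_digitWeight_triadicCell (w : ℕ → ℝ) (n k : ℕ) :
    ∫ x in triadicCell n k, digitWeight w n x = (∑ j ∈ Finset.range 3, w j) / 3 ^ (n + 1) := by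
  rw [triadicCell_eq_biUnion, integral_biUnion_finset _
    (fun _ _ => measurableSet_triadicCell _ _)
    (fun _ _ _ _ h => disjoint_triadicCell _ (by omega))
    (fun _ _ => integrableOn_digitWeight_triadicCell _ _ _ _), Finset.sum_div]
  refine Finset.sum_congr rfl fun j hj => ?_
  have hj3 := Finset.mem_range.1 hj
  have h : EqOn (digitWeight w n) (fun _ => w j) (triadicCell (n + 1) (3 * k + j)) := by
    intro x hx
    have hm : (3 * k + j) % 3 = j := by omega
    simp only [digitWeight, (mem_triadicCell_iff.1 hx).2, hm]
  rw [setIntegral_congr_fun (measurableSet_triadicCell _ _) h, setIntegral_const,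
    volume_real_triadicCell, smul_eq_mul]
  ring

lemma setIntegral_digitWeight_eq_zero {w : ℕ → ℝ} (hw : ∑ j ∈ Finset.range 3, w j = 0) (n : ℕ)
    {s : Set ℝ} (hs : MeasurableSet[triadicFiltration n] s) :
    ∫ x in s, digitWeight w n x ∂(volume.restrict (Ico 0 1)) = 0 := by
  classical
  rw [Measure.restrict_restrict (triadicFiltration.le n _ hs)]
  obtain ⟨B, -, rfl⟩ := hs
  have hU : (fun x : ℝ => ⌊3 ^ n * x⌋₊) ⁻¹' B ∩ Ico 0 1 =
      ⋃ k ∈ (Finset.range (3 ^ n)).filter (· ∈ B), triadicCell n k := by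
    ext x
    simp only [mem_inter_iff, mem_preimage, mem_iUnion, Finset.mem_filter, Finset.mem_range,
      exists_prop, mem_triadicCell_iff]
    constructor
    · rintro ⟨hB, hx⟩
      exact ⟨_, ⟨floor_three_pow_lt hx n, hB⟩, hx.1, rfl⟩
    · rintro ⟨k, ⟨hk, hB⟩, hx, rfl⟩
      refine ⟨hB, hx, ?_⟩
      rw [Nat.floor_lt (mul_nonneg (by positivity) hx)] at hk
      push_cast at hk
      exact (mul_lt_iff_lt_one_right (by positivity)).1 hk
  rw [hU, integral_biUnion_finset _ (fun _ _ => measurableSet_triadicCell _ _)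
    (fun _ _ _ _ h => disjoint_triadicCell _ h)
    (fun _ _ => integrableOn_digitWeight_triadicCell _ _ _ _)]
  simp [setIntegral_digitWeight_triadicCell, hw]

lemma martingale_digitWalk {w : ℕ → ℝ} (hw : ∑ j ∈ Finset.range 3, w j = 0) :
    Martingale (digitWalk w) triadicFiltration (volume.restrict (Ico 0 1)) := by
  have hint : ∀ n, Integrable (digitWalk w n) (volume.restrict (Ico 0 1)) := fun n =>
    integrable_finsetSum _ fun i _ => integrable_digitWeight w i _
  refine martingale_of_setIntegral_eq_succ (stronglyAdapted_digitWalk w) hint fun n s hs => ?_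
  have hsucc : digitWalk w (n + 1) = fun x => digitWalk w n x + digitWeight w n x := by
    ext x
    exact Finset.sum_range_succ _ _
  rw [hsucc, integral_add (hint n).integrableOn (integrable_digitWeight w n _).integrableOn,
    setIntegral_digitWeight_eq_zero hw n hs, add_zero]

/-- A centered walk driven by ternary digits almost surely does not tend to `-∞`. -/
lemma ae_not_tendsto_digitWalk_atBot {w : ℕ → ℝ} (hw : ∑ j ∈ Finset.range 3, w j = 0) :
    ∀ᵐ x ∂(volume.restrict (Ico (0 : ℝ) 1)),
      ¬ Tendsto (fun n => digitWalk w n x) atTop atBot := by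
  have hR : 0 ≤ ∑ j ∈ Finset.range 3, |w j| := Finset.sum_nonneg fun _ _ => abs_nonneg _
  have h := (martingale_digitWalk hw).bddAbove_range_iff_bddBelow_range
    (R := ⟨∑ j ∈ Finset.range 3, |w j|, hR⟩)
    (ae_of_all _ fun x n => by
      rw [digitWalk, Finset.sum_range_succ, digitWalk, add_sub_cancel_left]
      exact abs_digitWeight_le w n x)
  filter_upwards [h] with x hx ht
  exact not_bddBelow_of_tendsto_atBot ht (hx.1 (bddAbove_range_of_tendsto_atTop_atBot ht))

/-- The ratio of increments of an Okamoto function between a triadic interval and its `j`-th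
third. -/
noncomputable def okamotoRatio (a : ℝ) (j : ℕ) : ℝ := if j = 1 then 1 - 2 * a else a

namespace IsOkamoto

variable {a : ℝ} {F : ℝ → ℝ}

lemma map_zero (hF : IsOkamoto a F) (ha : a ≠ 1) : F 0 = 0 := by
  have h := (hF.2 0 (by simp)).1
  rw [zero_div] at h
  have : (1 - a) * F 0 = 0 := by linarith
  exact (mul_eq_zero.1 this).resolve_left (sub_ne_zero.2 ha.symm)

lemma map_one (hF : IsOkamoto a F) (ha : a ≠ 1) : F 1 = 1 := by
  have h := (hF.2 1 (by simp)).2.2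
  norm_num at h
  have : (1 - a) * (F 1 - 1) = 0 := by linarith
  exact sub_eq_zero.1 ((mul_eq_zero.1 this).resolve_left (sub_ne_zero.2 ha.symm))

lemma increment_succ (hF : IsOkamoto a F) (ha : a ≠ 1) (n k j : ℕ) (hk : k < 3 ^ n)
    (hj : j < 3) :
    F ((3 * k + j + 1) / 3 ^ (n + 1)) - F ((3 * k + j) / 3 ^ (n + 1)) =
      okamotoRatio a j * (F ((k + 1) / 3 ^ n) - F (k / 3 ^ n)) := by
  induction n generalizing k j with
  | zero =>
    obtain rfl : k = 0 := by simpa using hk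
    have h0 := hF.map_zero ha
    have h1 := hF.map_one ha
    have e0 := hF.2 0 (by simp)
    have e1 := hF.2 1 (by simp)
    interval_cases j <;> norm_num [okamotoRatio] at * <;> simp only [h0, h1, e0, e1] <;> ring
  | succ n ih =>
    have hI : ∀ (N : ℕ) (m : ℕ), m ≤ 3 ^ N → (m / 3 ^ N : ℝ) ∈ Icc (0 : ℝ) 1 := by
      intro N m hm
      refine ⟨by positivity, div_le_one_of_le₀ (by exact_mod_cast hm) (by positivity)⟩
    have hp : 3 ^ (n + 1) = 3 * 3 ^ n := pow_succ' 3 n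
    have hI' : ∀ m : ℕ, m ≤ 3 * 3 ^ n → (m / 3 ^ (n + 1) : ℝ) ∈ Icc (0 : ℝ) 1 :=
      fun m hm => hI (n + 1) m (by omega)
    rcases lt_or_ge k (3 ^ n) with h | h
    · have f1 := (hF.2 _ (hI n k h.le)).1
      have f2 := (hF.2 _ (hI n (k + 1) h)).1
      have f3 := (hF.2 _ (hI' (3 * k + j) (by omega))).1
      have f4 := (hF.2 _ (hI' (3 * k + j + 1) (by omega))).1
      have key := ih k j h hj
      push_cast at f1 f2 f3 f4
      simp only [pow_succ, ← div_div] at key f1 f2 f3 f4 ⊢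
      rw [f1, f2, f3, f4, ← mul_sub, key]
      ring
    rcases lt_or_ge k (2 * 3 ^ n) with h' | h'
    · obtain ⟨l, hl⟩ : ∃ l, k + l + 1 = 2 * 3 ^ n := ⟨2 * 3 ^ n - k - 1, by omega⟩
      obtain ⟨i, hi⟩ : ∃ i, j + i = 2 := ⟨2 - j, by omega⟩
      have f1 := (hF.2 _ (hI n (l + 1) (by omega))).2.1
      have f2 := (hF.2 _ (hI n l (by omega))).2.1
      have f3 := (hF.2 _ (hI' (3 * l + i + 1) (by omega))).2.1
      have f4 := (hF.2 _ (hI' (3 * l + i) (by omega))).2.1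
      have key := ih l i (by omega) (by omega)
      have hl' : (k : ℝ) = 2 * 3 ^ n - l - 1 := by
        have : (k + l + 1 : ℝ) = 2 * 3 ^ n := by exact_mod_cast hl
        linarith
      have hi' : (j : ℝ) = 2 - i := by
        have : (j + i : ℝ) = 2 := by exact_mod_cast hi
        linarith
      have hr : okamotoRatio a i = okamotoRatio a j := by
        unfold okamotoRatio
        congr 1
        exact propext ⟨by omega, by omega⟩
      push_cast at f1 f2 f3 f4
      have g1 : (2 - (l + 1) / 3 ^ n) / 3 = (k / 3 ^ (n + 1) : ℝ) := by
        rw [hl']; field_simp; ring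
      have g2 : (2 - l / 3 ^ n) / 3 = ((k + 1) / 3 ^ (n + 1) : ℝ) := by
        rw [hl']; field_simp; ring
      have g3 : (2 - (3 * l + i + 1) / 3 ^ (n + 1)) / 3 =
          ((3 * k + j) / 3 ^ (n + 1 + 1) : ℝ) := by
        rw [hl', hi']; field_simp; ring
      have g4 : (2 - (3 * l + i) / 3 ^ (n + 1)) / 3 =
          ((3 * k + j + 1) / 3 ^ (n + 1 + 1) : ℝ) := by
        rw [hl', hi']; field_simp; ring
      rw [g1] at f1
      rw [g2] at f2
      rw [g3] at f3
      rw [g4] at f4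
      rw [f1, f2, f3, f4]
      rw [hr] at key
      linear_combination (1 - 2 * a) * key
    · obtain ⟨l, rfl⟩ : ∃ l, k = 2 * 3 ^ n + l := ⟨k - 2 * 3 ^ n, by omega⟩
      have f1 := (hF.2 _ (hI n l (by omega))).2.2
      have f2 := (hF.2 _ (hI n (l + 1) (by omega))).2.2
      have f3 := (hF.2 _ (hI' (3 * l + j) (by omega))).2.2
      have f4 := (hF.2 _ (hI' (3 * l + j + 1) (by omega))).2.2
      have key := ih l j (by omega) hj
      push_cast at f1 f2 f3 f4 ⊢
      have g1 : (2 + l / 3 ^ n) / 3 = ((2 * 3 ^ n + l) / 3 ^ (n + 1) : ℝ) := by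
        field_simp; ring
      have g2 : (2 + (l + 1) / 3 ^ n) / 3 = ((2 * 3 ^ n + l + 1) / 3 ^ (n + 1) : ℝ) := by
        field_simp; ring
      have g3 : (2 + (3 * l + j) / 3 ^ (n + 1)) / 3 =
          ((3 * (2 * 3 ^ n + l) + j) / 3 ^ (n + 1 + 1) : ℝ) := by
        field_simp; ring
      have g4 : (2 + (3 * l + j + 1) / 3 ^ (n + 1)) / 3 =
          ((3 * (2 * 3 ^ n + l) + j + 1) / 3 ^ (n + 1 + 1) : ℝ) := by
        field_simp; ring
      rw [g1] at f1
      rw [g2] at f2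
      rw [g3] at f3
      rw [g4] at f4
      rw [f1, f2, f3, f4]
      linear_combination a * key

end IsOkamoto

/-- The slope of `F` over the triadic interval of generation `n` containing `x`. -/
noncomputable def triadicSlope (F : ℝ → ℝ) (n : ℕ) (x : ℝ) : ℝ :=
  (F ((⌊3 ^ n * x⌋₊ + 1) / 3 ^ n) - F (⌊3 ^ n * x⌋₊ / 3 ^ n)) * 3 ^ n

lemma IsOkamoto.triadicSlope_zero {a : ℝ} {F : ℝ → ℝ} (hF : IsOkamoto a F) (ha : a ≠ 1)
    {x : ℝ} (hx : x ∈ Ico (0 : ℝ) 1) : triadicSlope F 0 x = 1 := by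
  have h0 : ⌊x⌋₊ = 0 := Nat.floor_eq_zero.2 hx.2
  simp [triadicSlope, h0, hF.map_zero ha, hF.map_one ha]

lemma IsOkamoto.triadicSlope_succ {a : ℝ} {F : ℝ → ℝ} (hF : IsOkamoto a F) (ha : a ≠ 1)
    {x : ℝ} (hx : x ∈ Ico (0 : ℝ) 1) (n : ℕ) :
    triadicSlope F (n + 1) x =
      3 * okamotoRatio a (⌊3 ^ (n + 1) * x⌋₊ % 3) * triadicSlope F n x := by
  have h := hF.increment_succ ha n ⌊3 ^ n * x⌋₊ (⌊3 ^ (n + 1) * x⌋₊ % 3)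
    (floor_three_pow_lt hx n) (Nat.mod_lt _ (by norm_num))
  have hm : 3 * ⌊3 ^ n * x⌋₊ + ⌊3 ^ (n + 1) * x⌋₊ % 3 = ⌊3 ^ (n + 1) * x⌋₊ := by
    have := floor_three_pow_succ_div n x
    omega
  have hm' : (3 * ⌊3 ^ n * x⌋₊ + (⌊3 ^ (n + 1) * x⌋₊ % 3 : ℕ) : ℝ) = ⌊3 ^ (n + 1) * x⌋₊ := by
    exact_mod_cast hm
  rw [hm'] at h
  rw [triadicSlope, h, triadicSlope, pow_succ]
  ring

/-- Slopes over triadic intervals shrinking to `x` converge to the derivative at `x`. -/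
lemma tendsto_triadicSlope {F : ℝ → ℝ} {L x : ℝ} (hx : x ∈ Ico (0 : ℝ) 1)
    (h : HasDerivWithinAt F L (Icc 0 1) x) :
    Tendsto (fun n => triadicSlope F n x) atTop (nhds L) := by
  rw [hasDerivWithinAt_iff_isLittleO] at h
  rw [Metric.tendsto_atTop]
  intro ε hε
  have hb := h.bound (half_pos hε)
  obtain ⟨δ, hδ, hb⟩ := Metric.eventually_nhds_iff.1 (eventually_nhdsWithin_iff.1 hb)
  obtain ⟨N, hN⟩ := exists_pow_lt_of_lt_one hδ (by norm_num : (1 / 3 : ℝ) < 1)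
  refine ⟨N, fun n hn => ?_⟩
  have hp : (0 : ℝ) < 3 ^ n := by positivity
  have hsmall : 1 / 3 ^ n < δ := by
    rw [← one_div_pow]
    exact (pow_le_pow_of_le_one (by norm_num) (by norm_num) hn).trans_lt hN
  obtain ⟨hu, hv⟩ : x ∈ triadicCell n ⌊3 ^ n * x⌋₊ := mem_triadicCell_iff.2 ⟨hx.1, rfl⟩
  have hlt := floor_three_pow_lt hx n
  rw [triadicSlope]
  set k := ⌊3 ^ n * x⌋₊
  have hvu : ((k + 1) / 3 ^ n : ℝ) = k / 3 ^ n + 1 / 3 ^ n := by ring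
  have hv1 : ((k + 1) / 3 ^ n : ℝ) ≤ 1 :=
    div_le_one_of_le₀ (by exact_mod_cast hlt) hp.le
  have hu0 : (0 : ℝ) ≤ k / 3 ^ n := by positivity
  set u : ℝ := k / 3 ^ n
  set v : ℝ := (k + 1) / 3 ^ n
  have b1 := @hb u (by rw [Real.dist_eq, abs_lt]; constructor <;> linarith)
    ⟨hu0, by linarith [hx.2]⟩
  have b2 := @hb v (by rw [Real.dist_eq, abs_lt]; constructor <;> linarith)
    ⟨by linarith, hv1⟩
  simp only [smul_eq_mul, Real.norm_eq_abs] at b1 b2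
  rw [abs_of_nonpos (by linarith : u - x ≤ 0), abs_le] at b1
  rw [abs_of_nonneg (by linarith : 0 ≤ v - x), abs_le] at b2
  have hd : |F v - F u - L * (v - u)| ≤ ε / 2 * (v - u) := by
    rw [abs_le]
    constructor <;> linarith [b1.1, b1.2, b2.1, b2.2]
  have hw : v - u = 1 / 3 ^ n := by linarith
  rw [hw] at hd
  have hfin : (F v - F u) * 3 ^ n - L = (F v - F u - L * (1 / 3 ^ n)) * 3 ^ n := by
    field_simp
  rw [Real.dist_eq, hfin, abs_mul, abs_of_pos hp]
  calc _ ≤ ε / 2 * (1 / 3 ^ n) * 3 ^ n := by gcongr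
    _ = ε / 2 := by field_simp
    _ < ε := half_lt_self hε

lemma IsOkamoto.abs_triadicSlope {a : ℝ} {F : ℝ → ℝ} (hF : IsOkamoto a F)
    (ha : a ∈ Ioo (1 / 2 : ℝ) (2 / 3)) {x : ℝ} (hx : x ∈ Ico (0 : ℝ) 1) (n : ℕ) :
    |triadicSlope F n x| =
      Real.exp (digitWalk (fun j => Real.log |3 * okamotoRatio a j|) n x) := by
  have ha1 : a ≠ 1 := by linarith [ha.2]
  induction n with
  | zero => simp [hF.triadicSlope_zero ha1 hx, digitWalk]
  | succ n ih =>
    have hne : 3 * okamotoRatio a (⌊3 ^ (n + 1) * x⌋₊ % 3) ≠ 0 := by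
      refine mul_ne_zero (by norm_num) ?_
      unfold okamotoRatio
      split_ifs <;> linarith [ha.1]
    rw [hF.triadicSlope_succ ha1 hx, abs_mul, ih, digitWalk, digitWalk, Finset.sum_range_succ,
      Real.exp_add, digitWeight, Real.exp_log (abs_pos.2 hne), mul_comm]

lemma IsOkamoto.tendsto_digitWalk_atBot {a : ℝ} {F : ℝ → ℝ} (hF : IsOkamoto a F)
    (ha : a ∈ Ioo (1 / 2 : ℝ) (2 / 3)) {x : ℝ} (hx : x ∈ Ico (0 : ℝ) 1)
    (h : DifferentiableWithinAt ℝ F (Icc 0 1) x) :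
    Tendsto (fun n => digitWalk (fun j => Real.log |3 * okamotoRatio a j|) n x) atTop atBot := by
  have ha1 : a ≠ 1 := by linarith [ha.2]
  have hs := tendsto_triadicSlope hx h.hasDerivWithinAt
  have hdiff : Tendsto (fun n => 2 * |triadicSlope F (n + 1) x - triadicSlope F n x|)
      atTop (nhds 0) := by
    simpa using (((tendsto_add_atTop_iff_nat 1).2 hs).sub hs).abs.const_mul 2
  have hzero : Tendsto (fun n => |triadicSlope F n x|) atTop (nhds 0) := by
    refine squeeze_zero (fun _ => abs_nonneg _) (fun n => ?_) hdiff
    rw [hF.triadicSlope_succ ha1 hx, ← sub_one_mul, abs_mul, ← mul_assoc]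
    refine le_mul_of_one_le_left (abs_nonneg _) ?_
    unfold okamotoRatio
    split_ifs
    · rw [abs_of_nonpos] <;> linarith [ha.1]
    · rw [abs_of_nonneg] <;> linarith [ha.1]
  have hexp := hzero.congr (hF.abs_triadicSlope ha hx)
  exact Real.tendsto_exp_comp_nhds_zero.1 hexp

lemma sum_log_okamotoRatio {a : ℝ} (ha : a ∈ Ioo (1 / 2 : ℝ) (2 / 3))
    (hroot : 27 * a ^ 2 - 54 * a ^ 3 = -1) :
    ∑ j ∈ Finset.range 3, Real.log |3 * okamotoRatio a j| = 0 := by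
  have h1 : a ≠ 0 := by linarith [ha.1]
  have h2 : 1 - 2 * a ≠ 0 := by linarith [ha.1]
  simp only [Finset.sum_range_succ, Finset.sum_range_zero, okamotoRatio, Real.log_abs]
  norm_num
  rw [← Real.log_mul (by positivity) (by positivity),
    ← Real.log_mul (by positivity) (by positivity),
    show 3 * a * (3 * (1 - 2 * a)) * (3 * a) = -1 by linear_combination hroot]
  simp

/-- For the root `a₀` of `27a² − 54a³ = −1` in `(1/2, 2/3)`, the Okamoto function with
parameter `a₀` is differentiable (within `[0,1]`) only on a set of Lebesgue measure 0;
equivalently, the set of points of non-differentiability has measure 1. -/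
theorem okamoto_a0_ae_not_differentiable (a₀ : ℝ) (ha₀ : a₀ ∈ Set.Ioo (1 / 2 : ℝ) (2 / 3))
    (hroot : 27 * a₀ ^ 2 - 54 * a₀ ^ 3 = -1)
    (F : ℝ → ℝ) (hF : IsOkamoto a₀ F) :
    volume {x ∈ Set.Icc (0 : ℝ) 1 | DifferentiableWithinAt ℝ F (Set.Icc 0 1) x} = 0 ∧
    volume {x ∈ Set.Icc (0 : ℝ) 1 | ¬ DifferentiableWithinAt ℝ F (Set.Icc 0 1) x} = 1 := by
  have hnull : volume
      {x ∈ Icc (0 : ℝ) 1 | DifferentiableWithinAt ℝ F (Icc 0 1) x} = 0 := by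
    have h := ae_not_tendsto_digitWalk_atBot (sum_log_okamotoRatio ha₀ hroot)
    rw [ae_restrict_iff' measurableSet_Ico] at h
    refine measure_eq_zero_iff_ae_notMem.2 ?_
    filter_upwards [h, Measure.ae_ne volume (1 : ℝ)] with x hx hx1 ⟨hI, hd⟩
    have hI' : x ∈ Ico (0 : ℝ) 1 := ⟨hI.1, hI.2.lt_of_ne hx1⟩
    exact hx hI' (hF.tendsto_digitWalk_atBot ha₀ hI' hd)
  refine ⟨hnull, ?_⟩
  have hdiff : {x ∈ Icc (0 : ℝ) 1 | ¬ DifferentiableWithinAt ℝ F (Icc 0 1) x} =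
      Icc 0 1 \ {x ∈ Icc (0 : ℝ) 1 | DifferentiableWithinAt ℝ F (Icc 0 1) x} := by
    ext x
    simp only [mem_ofPred_eq, Set.mem_sdiff]
    tauto
  rw [hdiff, measure_sdiff_null hnull]
  simp
end

section
/- Let a₀ ∈ (1/2, 2/3) satisfy 27a₀² − 54a₀³ = −1. For every a with a₀ ≤ a < 1 and every Okamoto function F with parameter a, F is not differentiable within [0,1] at x for Lebesgue-almost every x ∈ [0,1]. -/
open Set MeasureTheory Filter

open scoped Topology

namespace Okamoto

/-- The increment of `F` over the triadic interval `[k / 3 ^ n, (k + 1) / 3 ^ n]`. -/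
noncomputable def incr (F : ℝ → ℝ) (n : ℕ) (k : ℤ) : ℝ :=
  F ((k + 1) / 3 ^ n) - F (k / 3 ^ n)

/-- The factor relating the increment over a triadic interval to the one over its parent. -/
noncomputable def weight (a : ℝ) (k : ℤ) : ℝ := if k % 3 = 1 then 1 - 2 * a else a

/-- The index of the triadic interval of order `n` containing `x`. -/
noncomputable def index (n : ℕ) (x : ℝ) : ℤ := ⌊3 ^ n * x⌋

section Increments

variable {a : ℝ} {F : ℝ → ℝ}

theorem incr_left (hF : IsOkamoto a F) (n : ℕ) (k : ℤ) (h0 : 0 ≤ k) (h1 : k < 3 ^ n) :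
    incr F (n + 1) k = a * incr F n k := by
  have h0' : (0 : ℝ) ≤ k := by exact_mod_cast h0
  have h1' : (k : ℝ) + 1 ≤ 3 ^ n := by exact_mod_cast h1
  have hp : (0 : ℝ) < 3 ^ n := by positivity
  have hu := (hF.2 (k / 3 ^ n) ⟨by positivity, by rw [div_le_one hp]; linarith⟩).1
  have hv := (hF.2 ((k + 1) / 3 ^ n) ⟨by positivity, by rw [div_le_one hp]; linarith⟩).1
  rw [div_div, ← pow_succ] at hu hv
  rw [incr, incr, hu, hv]
  ring

theorem incr_middle (hF : IsOkamoto a F) (n : ℕ) (k : ℤ) (h0 : 0 ≤ k) (h1 : k < 3 ^ n) :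
    incr F (n + 1) (2 * 3 ^ n - 1 - k) = (1 - 2 * a) * incr F n k := by
  have h0' : (0 : ℝ) ≤ k := by exact_mod_cast h0
  have h1' : (k : ℝ) + 1 ≤ 3 ^ n := by exact_mod_cast h1
  have hp : (0 : ℝ) < 3 ^ n := by positivity
  have hu := (hF.2 (k / 3 ^ n) ⟨by positivity, by rw [div_le_one hp]; linarith⟩).2.1
  have hv := (hF.2 ((k + 1) / 3 ^ n) ⟨by positivity, by rw [div_le_one hp]; linarith⟩).2.1
  have eu : (((2 * 3 ^ n - 1 - k : ℤ) : ℝ) + 1) / 3 ^ (n + 1) = (2 - k / 3 ^ n) / 3 := by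
    push_cast; field_simp; ring
  have ev : ((2 * 3 ^ n - 1 - k : ℤ) : ℝ) / 3 ^ (n + 1) = (2 - (k + 1) / 3 ^ n) / 3 := by
    push_cast; field_simp; ring
  rw [incr, incr, eu, ev, hu, hv]
  ring

theorem incr_right (hF : IsOkamoto a F) (n : ℕ) (k : ℤ) (h0 : 0 ≤ k) (h1 : k < 3 ^ n) :
    incr F (n + 1) (2 * 3 ^ n + k) = a * incr F n k := by
  have h0' : (0 : ℝ) ≤ k := by exact_mod_cast h0
  have h1' : (k : ℝ) + 1 ≤ 3 ^ n := by exact_mod_cast h1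
  have hp : (0 : ℝ) < 3 ^ n := by positivity
  have hu := (hF.2 (k / 3 ^ n) ⟨by positivity, by rw [div_le_one hp]; linarith⟩).2.2
  have hv := (hF.2 ((k + 1) / 3 ^ n) ⟨by positivity, by rw [div_le_one hp]; linarith⟩).2.2
  have eu : ((2 * 3 ^ n + k : ℤ) : ℝ) / 3 ^ (n + 1) = (2 + k / 3 ^ n) / 3 := by
    push_cast; field_simp; ring
  have ev : (((2 * 3 ^ n + k : ℤ) : ℝ) + 1) / 3 ^ (n + 1) = (2 + (k + 1) / 3 ^ n) / 3 := by
    push_cast; field_simp; ring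
  rw [incr, incr, eu, ev, hu, hv]
  ring

/-- The increment over a triadic interval is a fixed multiple of the one over its parent. -/
theorem incr_succ (hF : IsOkamoto a F) (n : ℕ) :
    ∀ k : ℤ, 0 ≤ k → k < 3 ^ (n + 1) →
      incr F (n + 1) k = weight a k * incr F n (k / 3) := by
  induction n with
  | zero =>
    intro k h0 h1
    have h1' : k < 3 := by simpa using h1
    have hl := incr_left hF 0 0 le_rfl (by norm_num)
    have hm := incr_middle hF 0 0 le_rfl (by norm_num)
    have hr := incr_right hF 0 0 le_rfl (by norm_num)
    norm_num at hl hm hr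
    interval_cases k <;> simp [weight, hl, hm, hr]
  | succ n ih =>
    intro k h0 h1
    have hp : (0 : ℤ) < 3 ^ n := by positivity
    have e1 : (3 : ℤ) ^ (n + 1) = 3 * 3 ^ n := by ring
    have e2 : (3 : ℤ) ^ (n + 1 + 1) = 9 * 3 ^ n := by ring
    rcases lt_or_ge k (3 ^ (n + 1)) with hk | hk
    · rw [incr_left hF (n + 1) k h0 hk, ih k h0 hk,
        incr_left hF n (k / 3) (by omega) (by omega)]
      ring
    rcases lt_or_ge k (2 * 3 ^ (n + 1)) with hk' | hk'
    · obtain ⟨j, rfl⟩ : ∃ j, k = 2 * 3 ^ (n + 1) - 1 - j := ⟨2 * 3 ^ (n + 1) - 1 - k, by ring⟩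
      have hw : weight a (2 * 3 ^ (n + 1) - 1 - j) = weight a j := by
        unfold weight
        congr 1
        rw [e1]
        apply propext
        omega
      have hd : (2 * 3 ^ (n + 1) - 1 - j) / 3 = 2 * 3 ^ n - 1 - j / 3 := by omega
      rw [hw, hd, incr_middle hF (n + 1) j (by omega) (by omega), ih j (by omega) (by omega),
        incr_middle hF n (j / 3) (by omega) (by omega)]
      ring
    · obtain ⟨j, rfl⟩ : ∃ j, k = 2 * 3 ^ (n + 1) + j := ⟨k - 2 * 3 ^ (n + 1), by ring⟩
      have hw : weight a (2 * 3 ^ (n + 1) + j) = weight a j := by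
        unfold weight
        congr 1
        rw [e1]
        apply propext
        omega
      have hd : (2 * 3 ^ (n + 1) + j) / 3 = 2 * 3 ^ n + j / 3 := by omega
      rw [hw, hd, incr_right hF (n + 1) j (by omega) (by omega), ih j (by omega) (by omega),
        incr_right hF n (j / 3) (by omega) (by omega)]
      ring

theorem incr_zero (hF : IsOkamoto a F) (ha : a < 1) : incr F 0 0 = 1 := by
  have h0 := (hF.2 0 (by simp)).1
  have h1 := (hF.2 1 (by simp)).2.2
  rw [zero_div] at h0
  norm_num at h1
  have h0' : F 0 = 0 := by
    have : (1 - a) * F 0 = 0 := by linarith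
    exact (mul_eq_zero.1 this).resolve_left (by linarith)
  have h1' : F 1 = 1 := by
    have : (1 - a) * (F 1 - 1) = 0 := by linarith
    rcases mul_eq_zero.1 this with h | h <;> linarith
  simp [incr, h0', h1']

end Increments

section Index

theorem index_succ_div (n : ℕ) (x : ℝ) : index (n + 1) x / 3 = index n x := by
  have := Int.natCast_mul_floor_div_cancel (n := 3) (by norm_num) ((3 : ℝ) ^ n * x)
  rw [index, index, ← this]
  push_cast
  ring_nf

theorem index_nonneg (n : ℕ) {x : ℝ} (hx : 0 ≤ x) : 0 ≤ index n x :=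
  Int.floor_nonneg.2 (by positivity)

theorem index_lt (n : ℕ) {x : ℝ} (hx : x < 1) : index n x < 3 ^ n := by
  rw [index, Int.floor_lt]
  push_cast
  have : (0 : ℝ) < 3 ^ n := by positivity
  nlinarith

theorem mem_Ico_iff_index (n : ℕ) (x : ℝ) :
    x ∈ Ico (0 : ℝ) 1 ↔ 0 ≤ index n x ∧ index n x < 3 ^ n := by
  refine ⟨fun h => ⟨index_nonneg n h.1, index_lt n h.2⟩, fun ⟨h0, h1⟩ => ?_⟩
  have hp : (0 : ℝ) < 3 ^ n := by positivity
  rw [index, Int.floor_nonneg] at h0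
  rw [index, Int.floor_lt] at h1
  push_cast at h1
  exact ⟨nonneg_of_mul_nonneg_right h0 hp, by nlinarith⟩

theorem measurable_index (n : ℕ) : Measurable (index n) :=
  Int.measurable_floor.comp (measurable_const_mul _)

theorem index_zero_of_mem {x : ℝ} (hx : x ∈ Ico (0 : ℝ) 1) : index 0 x = 0 := by
  have := index_nonneg 0 hx.1
  have := index_lt 0 hx.2
  omega

theorem volume_index_preimage_add (n : ℕ) (C : Set ℤ) (i : ℤ) :
    volume (index n ⁻¹' ((fun m => m + i) ⁻¹' C)) = volume (index n ⁻¹' C) := by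
  rw [← measure_preimage_add_right volume ((i : ℝ) / 3 ^ n) (index n ⁻¹' C)]
  congr 1
  ext x
  have : index n (x + i / 3 ^ n) = index n x + i := by
    rw [index, index, mul_add, mul_div_cancel₀ _ (by positivity), Int.floor_add_intCast]
  simp [this]

/-- The filtration generated by the triadic intervals. -/
noncomputable def triadic : Filtration ℕ (inferInstance : MeasurableSpace ℝ) where
  seq n := MeasurableSpace.comap (index n) ⊤
  mono' := by
    refine monotone_nat_of_le_succ fun n => ?_
    rintro _ ⟨A, -, rfl⟩
    exact ⟨(fun m => m / 3) ⁻¹' A, trivial, by ext x; simp [index_succ_div]⟩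
  le' n := (measurable_index n).comap_le

/-- In each triadic interval the three possible next digits are equally likely. -/
theorem volume_index_succ_mod (n : ℕ) (A : Set ℤ) {i : ℤ} (h0 : 0 ≤ i) (h1 : i < 3) :
    volume (index n ⁻¹' A ∩ {x | index (n + 1) x % 3 = i} ∩ Ico 0 1) =
      volume (index n ⁻¹' A ∩ {x | index (n + 1) x % 3 = 0} ∩ Ico 0 1) := by
  have key : ∀ j : ℤ, index n ⁻¹' A ∩ {x | index (n + 1) x % 3 = j} ∩ Ico 0 1 =
      index (n + 1) ⁻¹' {m | m / 3 ∈ A ∧ m % 3 = j ∧ 0 ≤ m / 3 ∧ m / 3 < 3 ^ n} := by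
    intro j
    ext x
    rw [mem_inter_iff, mem_Ico_iff_index n]
    simp [index_succ_div, and_assoc]
  rw [key, key, ← volume_index_preimage_add (n + 1) _ i]
  congr 2
  ext m
  simp only [mem_preimage, mem_ofPred_eq]
  by_cases hm : m % 3 = 0
  · have : (m + i) / 3 = m / 3 := by omega
    rw [this]
    have : (m + i) % 3 = i := by omega
    simp [hm, this]
  · have : (m + i) % 3 ≠ i := by omega
    simp [hm, this]

end Index

section Martingale

/-- The logarithm of the modulus of the slope over the triadic interval containing `x`. -/
noncomputable def logSlope (a : ℝ) (n : ℕ) (x : ℝ) : ℝ :=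
  ∑ i ∈ Finset.range n, Real.log |3 * weight a (index (i + 1) x)|

theorem logSlope_succ (a : ℝ) (n : ℕ) (x : ℝ) :
    logSlope a (n + 1) x = logSlope a n x + Real.log |3 * weight a (index (n + 1) x)| :=
  Finset.sum_range_succ _ _

theorem stronglyAdapted_logSlope (a : ℝ) : StronglyAdapted triadic (logSlope a) := by
  intro n
  refine Finset.stronglyMeasurable_fun_sum _ fun i hi => ?_
  refine StronglyMeasurable.mono ?_ (triadic.mono (Finset.mem_range.1 hi))
  have h : Measurable[triadic (i + 1)] (index (i + 1)) := comap_measurable _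
  have h2 : Measurable fun m : ℤ => Real.log |3 * weight a m| := measurable_from_top
  exact (h2.comp h).stronglyMeasurable

theorem abs_log_weight_le (a : ℝ) (k : ℤ) :
    |(Real.log |3 * weight a k|)| ≤ |Real.log (3 * a)| + |Real.log (3 * (1 - 2 * a))| := by
  unfold weight
  rw [Real.log_abs]
  split_ifs
  · linarith [abs_nonneg (Real.log (3 * a))]
  · linarith [abs_nonneg (Real.log (3 * (1 - 2 * a)))]

theorem integrable_log_weight (a : ℝ) (n : ℕ) :
    Integrable (fun x => Real.log |3 * weight a (index n x)|) (volume.restrict (Ico 0 1)) := by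
  have h2 : Measurable fun m : ℤ => Real.log |3 * weight a m| := measurable_from_top
  refine Integrable.of_bound (h2.comp (measurable_index n)).aestronglyMeasurable
    (|Real.log (3 * a)| + |Real.log (3 * (1 - 2 * a))|) (Eventually.of_forall fun x => ?_)
  exact abs_log_weight_le a _

theorem integrable_logSlope (a : ℝ) (n : ℕ) :
    Integrable (logSlope a n) (volume.restrict (Ico 0 1)) :=
  integrable_finsetSum _ fun i _ => integrable_log_weight a (i + 1)

theorem setIntegral_log_weight_nonneg {a : ℝ}
    (ha : 0 ≤ 2 * Real.log |3 * a| + Real.log |3 * (1 - 2 * a)|) (n : ℕ) (A : Set ℤ) :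
    0 ≤ ∫ x in index n ⁻¹' A, Real.log |3 * weight a (index (n + 1) x)|
      ∂(volume.restrict (Ico (0 : ℝ) 1)) := by
  set μ := volume.restrict (Ico (0 : ℝ) 1)
  set B := index n ⁻¹' A
  have hB : MeasurableSet B := measurable_index n trivial
  let D : ℤ → Set ℝ := fun i => {x | index (n + 1) x % 3 = i}
  have hD : ∀ i, MeasurableSet (D i) := fun i =>
    measurable_index (n + 1) (t := {m | m % 3 = i}) trivial
  have hμ : ∀ i, 0 ≤ i → i < 3 → μ.real (B ∩ D i) = μ.real (B ∩ D 0) := by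
    intro i h0 h1
    simp only [measureReal_def, μ]
    rw [Measure.restrict_apply (hB.inter (hD i)), Measure.restrict_apply (hB.inter (hD 0)),
      volume_index_succ_mod n A h0 h1]
  have hunion : B = (B ∩ D 0 ∪ B ∩ D 1) ∪ B ∩ D 2 := by
    ext x
    have : index (n + 1) x % 3 = 0 ∨ index (n + 1) x % 3 = 1 ∨ index (n + 1) x % 3 = 2 := by
      omega
    simp only [mem_union, mem_inter_iff, D, mem_ofPred_eq]
    tauto
  have hdisj : ∀ i j, i ≠ j → Disjoint (B ∩ D i) (B ∩ D j) := fun i j hij =>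
    disjoint_left.2 fun x hx hy => hij (hx.2.symm.trans hy.2)
  have hint : ∀ s, IntegrableOn (fun x => Real.log |3 * weight a (index (n + 1) x)|) s μ :=
    fun s => (integrable_log_weight a (n + 1)).integrableOn
  have hval : ∀ i, 0 ≤ i → i < 3 →
      ∫ x in B ∩ D i, Real.log |3 * weight a (index (n + 1) x)| ∂μ =
        μ.real (B ∩ D 0) * Real.log |3 * weight a i| := by
    intro i h0 h1
    rw [setIntegral_congr_fun (g := fun _ => Real.log |3 * weight a i|) (hB.inter (hD i)),
      setIntegral_const, hμ i h0 h1, smul_eq_mul]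
    intro x hx
    have h : index (n + 1) x % 3 = i % 3 := by
      have : index (n + 1) x % 3 = i := hx.2
      omega
    simp only [weight, h]
  rw [hunion, setIntegral_union _ ((hB.inter (hD 2))) (hint _) (hint _),
    setIntegral_union (hdisj 0 1 (by norm_num)) ((hB.inter (hD 1))) (hint _) (hint _),
    hval 0 (by norm_num) (by norm_num), hval 1 (by norm_num) (by norm_num),
    hval 2 (by norm_num) (by norm_num)]
  · have := mul_nonneg (measureReal_nonneg (μ := μ) (s := B ∩ D 0)) ha
    norm_num [weight]
    norm_num at this
    linarith
  · exact Disjoint.union_left (hdisj 0 2 (by norm_num)) (hdisj 1 2 (by norm_num))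

theorem submartingale_logSlope {a : ℝ}
    (ha : 0 ≤ 2 * Real.log |3 * a| + Real.log |3 * (1 - 2 * a)|) :
    Submartingale (logSlope a) triadic (volume.restrict (Ico (0 : ℝ) 1)) := by
  refine submartingale_of_setIntegral_le_succ (stronglyAdapted_logSlope a)
    (integrable_logSlope a) ?_
  rintro n _ ⟨A, -, rfl⟩
  simp only [logSlope_succ]
  rw [integral_add (integrable_logSlope a n).integrableOn
    (integrable_log_weight a (n + 1)).integrableOn]
  linarith [setIntegral_log_weight_nonneg ha n A]

theorem ae_not_tendsto_logSlope_atBot {a : ℝ}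
    (ha : 0 ≤ 2 * Real.log |3 * a| + Real.log |3 * (1 - 2 * a)|) :
    ∀ᵐ x ∂(volume.restrict (Ico (0 : ℝ) 1)),
      ¬ Tendsto (fun n => logSlope a n x) atTop atBot := by
  have hb : ∀ᵐ x ∂(volume.restrict (Ico (0 : ℝ) 1)), ∀ n,
      |logSlope a (n + 1) x - logSlope a n x| ≤
        ((|Real.log (3 * a)| + |Real.log (3 * (1 - 2 * a))|).toNNReal : ℝ) := by
    refine Eventually.of_forall fun x n => ?_
    rw [logSlope_succ, add_sub_cancel_left, Real.coe_toNNReal _ (by positivity)]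
    exact abs_log_weight_le a _
  filter_upwards [(submartingale_logSlope ha).bddAbove_iff_exists_tendsto hb] with x hx h
  obtain ⟨c, hc⟩ := hx.1 (bddAbove_range_of_tendsto_atTop_atBot h)
  exact not_tendsto_nhds_of_tendsto_atBot h c hc

end Martingale

section Slope

variable {a : ℝ} {F : ℝ → ℝ}

theorem abs_slope_eq_exp (hF : IsOkamoto a F) (ha : 1 / 2 < a) (ha1 : a < 1) {x : ℝ}
    (hx : x ∈ Ico (0 : ℝ) 1) (n : ℕ) :
    |3 ^ n * incr F n (index n x)| = Real.exp (logSlope a n x) := by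
  induction n with
  | zero => simp [index_zero_of_mem hx, incr_zero hF ha1, logSlope]
  | succ n ih =>
    have hw : weight a (index (n + 1) x) ≠ 0 := by
      unfold weight
      split_ifs <;> linarith
    rw [incr_succ hF n _ (index_nonneg _ hx.1) (index_lt _ hx.2), index_succ_div, logSlope_succ,
      Real.exp_add, Real.exp_log (by positivity), ← ih, ← abs_mul]
    congr 1
    ring

/-- Difference quotients over intervals shrinking to `x` converge to the derivative. -/
theorem tendsto_slope_index {L : ℝ} {x : ℝ} (hx : x ∈ Ico (0 : ℝ) 1)
    (h : HasDerivWithinAt F L (Icc 0 1) x) :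
    Tendsto (fun n => 3 ^ n * incr F n (index n x)) atTop (𝓝 L) := by
  rw [Metric.tendsto_atTop]
  intro ε hε
  have ho := (hasDerivWithinAt_iff_isLittleO.1 h).def (half_pos hε)
  obtain ⟨δ, hδ, hball⟩ := Metric.mem_nhdsWithin_iff.1 ho
  obtain ⟨N, hN⟩ := exists_pow_lt_of_lt_one hδ (show (1 / 3 : ℝ) < 1 by norm_num)
  refine ⟨N, fun n hn => ?_⟩
  have hp : (0 : ℝ) < 3 ^ n := by positivity
  have hlt : 1 / 3 ^ n < δ := by
    rw [← one_div_pow]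
    exact (pow_le_pow_of_le_one (by norm_num) (by norm_num) hn).trans_lt hN
  have hk0 : (0 : ℝ) ≤ index n x := by exact_mod_cast index_nonneg n hx.1
  have hk1 : (index n x : ℝ) + 1 ≤ 3 ^ n := by exact_mod_cast index_lt n hx.2
  have hu : (index n x : ℝ) / 3 ^ n ≤ x := by
    rw [div_le_iff₀ hp, mul_comm]
    exact Int.floor_le _
  have hv : x < (index n x + 1 : ℝ) / 3 ^ n := by
    rw [lt_div_iff₀ hp, mul_comm]
    exact Int.lt_floor_add_one _
  have huv : (index n x + 1 : ℝ) / 3 ^ n = index n x / 3 ^ n + 1 / 3 ^ n := by ring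
  have hu0 : (0 : ℝ) ≤ index n x / 3 ^ n := by positivity
  have hv1 : (index n x + 1 : ℝ) / 3 ^ n ≤ 1 := by rwa [div_le_one hp]
  rw [Real.dist_eq, incr]
  generalize (index n x + 1 : ℝ) / 3 ^ n = v at *
  generalize (index n x : ℝ) / 3 ^ n = u at *
  have hq : 3 ^ n * (v - u) = 1 := by rw [huv]; field_simp; ring
  have bu := hball (a := u) ⟨by rw [Metric.mem_ball, Real.dist_eq, abs_lt]; constructor <;> linarith,
    by linarith, by linarith⟩
  have bv := hball (a := v) ⟨by rw [Metric.mem_ball, Real.dist_eq, abs_lt]; constructor <;> linarith,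
    by linarith, by linarith⟩
  simp only [mem_ofPred_eq, smul_eq_mul, Real.norm_eq_abs] at bu bv
  rw [abs_of_nonpos (by linarith : u - x ≤ 0), abs_le] at bu
  rw [abs_of_nonneg (by linarith : 0 ≤ v - x), abs_le] at bv
  have e : 3 ^ n * (F v - F u) - L = 3 ^ n * (F v - F u - L * (v - u)) := by
    linear_combination L * hq
  have hd : |F v - F u - L * (v - u)| ≤ ε / 2 * (v - u) := by
    rw [abs_le]
    constructor <;> linarith [bu.1, bu.2, bv.1, bv.2]
  rw [e, abs_mul, abs_of_pos hp]
  have := mul_le_mul_of_nonneg_left hd hp.le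
  have : 3 ^ n * (ε / 2 * (v - u)) = ε / 2 := by linear_combination (ε / 2) * hq
  linarith

theorem tendsto_logSlope_atBot (hF : IsOkamoto a F) (ha : 1 / 2 < a) (ha1 : a < 1) {x : ℝ}
    (hx : x ∈ Ico (0 : ℝ) 1) (hd : DifferentiableWithinAt ℝ F (Icc 0 1) x) :
    Tendsto (fun n => logSlope a n x) atTop atBot := by
  have ht := tendsto_slope_index hx hd.hasDerivWithinAt
  set L := derivWithin F (Icc 0 1) x
  set S : ℕ → ℝ := fun n => 3 ^ n * incr F n (index n x)
  have hstep : ∀ n, |S n| ≤ 2 * |S (n + 1) - S n| := by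
    intro n
    have e : S (n + 1) - S n = (3 * weight a (index (n + 1) x) - 1) * S n := by
      simp only [S]
      rw [incr_succ hF n _ (index_nonneg _ hx.1) (index_lt _ hx.2), index_succ_div]
      ring
    have hw : 1 / 2 ≤ |3 * weight a (index (n + 1) x) - 1| := by
      unfold weight
      split_ifs
      · exact le_abs.2 (Or.inr (by linarith))
      · exact le_abs.2 (Or.inl (by linarith))
    rw [e, abs_mul _ (S n)]
    linarith [mul_le_mul_of_nonneg_right hw (abs_nonneg (S n))]
  have hdiff : Tendsto (fun n => 2 * |S (n + 1) - S n|) atTop (𝓝 0) := by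
    simpa using ((((tendsto_add_atTop_iff_nat 1).2 ht).sub ht).abs).const_mul 2
  have h0 : Tendsto (fun n => |S n|) atTop (𝓝 0) :=
    squeeze_zero (fun n => abs_nonneg _) hstep hdiff
  rw [← Real.tendsto_exp_comp_nhds_zero]
  simpa only [S, abs_slope_eq_exp hF ha ha1 hx] using h0

end Slope

end Okamoto

/-- For every `a` with `a₀ ≤ a < 1`, the Okamoto function with parameter `a` is
non-differentiable within `[0,1]` at Lebesgue-almost every `x ∈ [0,1]`. -/
theorem okamoto_ae_not_differentiable_of_ge_a0 (a₀ : ℝ)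
    (ha₀ : a₀ ∈ Set.Ioo (1 / 2 : ℝ) (2 / 3))
    (hroot : 27 * a₀ ^ 2 - 54 * a₀ ^ 3 = -1)
    (a : ℝ) (ha : a₀ ≤ a) (ha1 : a < 1)
    (F : ℝ → ℝ) (hF : IsOkamoto a F) :
    ∀ᵐ x ∂(volume.restrict (Set.Icc (0 : ℝ) 1)),
      ¬ DifferentiableWithinAt ℝ F (Set.Icc 0 1) x := by
  have hhalf : 1 / 2 < a := ha₀.1.trans_le ha
  have hprod : 1 ≤ 27 * a ^ 2 * (2 * a - 1) := by
    have h1 : a₀ ^ 2 ≤ a ^ 2 := pow_le_pow_left₀ (by linarith [ha₀.1]) ha 2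
    nlinarith [mul_le_mul h1 (by linarith : 2 * a₀ - 1 ≤ 2 * a - 1) (by linarith [ha₀.1])
      (sq_nonneg a)]
  have hlog : 0 ≤ 2 * Real.log |3 * a| + Real.log |3 * (1 - 2 * a)| := by
    have e : 2 * Real.log |3 * a| + Real.log |3 * (1 - 2 * a)| =
        Real.log (27 * a ^ 2 * (2 * a - 1)) := by
      rw [Real.log_abs, Real.log_abs, ← Real.log_neg_eq_log (3 * (1 - 2 * a)),
        show 27 * a ^ 2 * (2 * a - 1) = (3 * a) ^ 2 * -(3 * (1 - 2 * a)) by ring,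
        Real.log_mul (x := (3 * a) ^ 2) (by positivity) (by linarith), Real.log_pow]
      norm_num
    rw [e]
    exact Real.log_nonneg hprod
  rw [← restrict_Ico_eq_restrict_Icc]
  filter_upwards [Okamoto.ae_not_tendsto_logSlope_atBot hlog,
    ae_restrict_mem measurableSet_Ico] with x hx hmem hd
  exact hx (Okamoto.tendsto_logSlope_atBot hF hhalf ha1 hmem hd)
end

section
/- Let a₀ ∈ (1/2, 2/3) satisfy 27a₀² − 54a₀³ = −1. For every a ∈ (0, 1/3) ∪ (1/3, a₀) and every Okamoto function F with parameter a, for Lebesgue-almost every x ∈ [0,1] the derivative of F within [0,1] at x exists and equals 0. -/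
open Set MeasureTheory Filter

/-- Weight of the `k`-th triadic interval of level `n`: the product of a factor `p` for each outer
third and `q` for each middle third (whose orientation is reversed) in its address. -/
noncomputable def triadicWeight (p q : ℝ) : ℕ → ℕ → ℝ
  | 0, _ => 1
  | n + 1, k =>
    if k < 3 ^ n then p * triadicWeight p q n k
    else if k < 2 * 3 ^ n then q * triadicWeight p q n (2 * 3 ^ n - 1 - k)
    else p * triadicWeight p q n (k - 2 * 3 ^ n)

lemma triadicWeight_nonneg {p q : ℝ} (hp : 0 ≤ p) (hq : 0 ≤ q) (n k : ℕ) :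
    0 ≤ triadicWeight p q n k := by
  induction n generalizing k with
  | zero => simp [triadicWeight]
  | succ n ih =>
    simp only [triadicWeight]
    split_ifs <;> exact mul_nonneg (by assumption) (ih _)

lemma sum_triadicWeight_rpow {p q : ℝ} (hp : 0 ≤ p) (hq : 0 ≤ q) (s : ℝ) (n : ℕ) :
    ∑ k ∈ Finset.range (3 ^ n), triadicWeight p q n k ^ s = (2 * p ^ s + q ^ s) ^ n := by
  induction n with
  | zero => simp [triadicWeight]
  | succ n ih =>
    have hpow : 3 ^ (n + 1) = 3 ^ n + 3 ^ n + 3 ^ n := by ring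
    have h3 : 0 < 3 ^ n := by positivity
    have left : ∀ k ∈ Finset.range (3 ^ n),
        triadicWeight p q (n + 1) k ^ s = p ^ s * triadicWeight p q n k ^ s := by
      intro k hk
      rw [triadicWeight, if_pos (Finset.mem_range.1 hk),
        Real.mul_rpow hp (triadicWeight_nonneg hp hq _ _)]
    have middle : ∀ k ∈ Finset.range (3 ^ n),
        triadicWeight p q (n + 1) (3 ^ n + k) ^ s =
          q ^ s * triadicWeight p q n (3 ^ n - 1 - k) ^ s := by
      intro k hk
      have hk := Finset.mem_range.1 hk
      rw [triadicWeight, if_neg (by omega), if_pos (by omega),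
        Real.mul_rpow hq (triadicWeight_nonneg hp hq _ _)]
      congr 3
      omega
    have right : ∀ k ∈ Finset.range (3 ^ n),
        triadicWeight p q (n + 1) (3 ^ n + 3 ^ n + k) ^ s = p ^ s * triadicWeight p q n k ^ s := by
      intro k hk
      rw [triadicWeight, if_neg (by omega), if_neg (by omega),
        Real.mul_rpow hp (triadicWeight_nonneg hp hq _ _)]
      congr 3
      omega
    rw [hpow, Finset.sum_range_add, Finset.sum_range_add, Finset.sum_congr rfl left,
      Finset.sum_congr rfl middle, Finset.sum_congr rfl right, ← Finset.mul_sum, ← Finset.mul_sum,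
      Finset.sum_range_reflect (fun k => triadicWeight p q n k ^ s), ih]
    ring

lemma exists_pos_rpow_add_lt_three {p q : ℝ} (hp : 0 < p) (hq : 0 ≤ q) (h : p ^ 2 * q < 1) :
    ∃ s : ℝ, 0 < s ∧ 2 * p ^ s + q ^ s < 3 := by
  rcases hq.eq_or_lt with rfl | hq
  · have hcont : ContinuousAt (fun s : ℝ => 2 * p ^ s) 0 :=
      continuousAt_const.mul (Real.continuousAt_const_rpow hp.ne')
    have hlt : ∀ᶠ s in nhds (0 : ℝ), 2 * p ^ s < 3 :=
      hcont.eventually (gt_mem_nhds (by norm_num))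
    obtain ⟨s, hs, hs0⟩ :=
      ((hlt.filter_mono nhdsWithin_le_nhds).and (self_mem_nhdsWithin (s := Ioi (0 : ℝ)))).exists
    exact ⟨s, hs0, by simpa [Real.zero_rpow (ne_of_gt hs0)] using hs⟩
  · have hderiv : HasDerivAt (fun s : ℝ => 2 * p ^ s + q ^ s) (2 * Real.log p + Real.log q) 0 := by
      have := ((Real.hasStrictDerivAt_const_rpow hp 0).hasDerivAt.const_mul 2).add
        (Real.hasStrictDerivAt_const_rpow hq 0).hasDerivAt
      rw [Real.rpow_zero, Real.rpow_zero, one_mul, one_mul] at this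
      exact this
    have hneg : 2 * Real.log p + Real.log q < 0 := by
      have hlog := Real.log_neg (by positivity) h
      rw [Real.log_mul (by positivity) hq.ne', Real.log_pow] at hlog
      exact_mod_cast hlog
    have hslope := (hasDerivAt_iff_tendsto_slope.1 hderiv).eventually (gt_mem_nhds hneg)
    have hle : nhdsWithin (0 : ℝ) (Ioi 0) ≤ nhdsWithin 0 {0}ᶜ :=
      nhdsWithin_mono _ fun s hs => ne_of_gt hs
    obtain ⟨s, hs, hs0⟩ :=
      ((hslope.filter_mono hle).and (self_mem_nhdsWithin (s := Ioi (0 : ℝ)))).exists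
    refine ⟨s, hs0, ?_⟩
    have hs0 : (0 : ℝ) < s := hs0
    rw [slope_def_field, sub_zero, div_lt_iff₀ hs0, zero_mul] at hs
    simp only [Real.rpow_zero] at hs
    linarith

lemma sq_mul_abs_lt_one {a a₀ : ℝ} (ha₀ : a₀ ∈ Set.Ioo (1 / 2 : ℝ) (2 / 3))
    (hroot : 27 * a₀ ^ 2 - 54 * a₀ ^ 3 = -1)
    (ha : a ∈ Set.Ioo (0 : ℝ) (1 / 3) ∪ Set.Ioo (1 / 3 : ℝ) a₀) :
    (3 * a) ^ 2 * (3 * |2 * a - 1|) < 1 := by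
  obtain ⟨hpos, hne, hlt⟩ : 0 < a ∧ a ≠ 1 / 3 ∧ a < a₀ := by
    rcases ha with ⟨h0, h1⟩ | ⟨h0, h1⟩
    · exact ⟨h0, h1.ne, by linarith [ha₀.1]⟩
    · exact ⟨by linarith, h0.ne', h1⟩
  rcases le_total (2 * a - 1) 0 with h | h
  · rw [abs_of_nonpos h]
    have : 0 < (3 * a - 1) ^ 2 := by
      have : 3 * a - 1 ≠ 0 := fun h => hne (by linarith)
      positivity
    nlinarith [mul_pos this (show 0 < 6 * a + 1 by linarith)]
  · rw [abs_of_nonneg h]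
    have hsq : a ^ 2 < a₀ ^ 2 := by gcongr
    have : a ^ 2 * (2 * a - 1) < a₀ ^ 2 * (2 * a₀ - 1) := by
      apply mul_lt_mul'' hsq (by linarith) (by positivity) h
    nlinarith

lemma mem_Icc_zero_one_of_pow_mul {n k : ℕ} (hk : k < 3 ^ n) {t : ℝ}
    (ht : 3 ^ n * t ∈ Icc (k : ℝ) (k + 1)) : t ∈ Icc (0 : ℝ) 1 := by
  have hk' : (k : ℝ) + 1 ≤ 3 ^ n := by exact_mod_cast hk
  have h3 : (0 : ℝ) < 3 ^ n := by positivity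
  constructor
  · exact nonneg_of_mul_nonneg_right ((Nat.cast_nonneg k).trans ht.1) h3
  · exact le_of_mul_le_mul_left (by linarith [ht.2]) h3

lemma IsOkamoto.abs_sub_le_triadicWeight {a M : ℝ} {F : ℝ → ℝ} (ha : 0 ≤ a) (hF : IsOkamoto a F)
    (hM : ∀ x ∈ Icc (0 : ℝ) 1, ∀ y ∈ Icc (0 : ℝ) 1, |F x - F y| ≤ M) (n k : ℕ) (hk : k < 3 ^ n)
    (x y : ℝ) (hx : 3 ^ n * x ∈ Icc (k : ℝ) (k + 1)) (hy : 3 ^ n * y ∈ Icc (k : ℝ) (k + 1)) :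
    |F x - F y| * 3 ^ n ≤ M * triadicWeight (3 * a) (3 * |2 * a - 1|) n k := by
  induction n generalizing k x y with
  | zero =>
    simpa [triadicWeight] using
      hM x (mem_Icc_zero_one_of_pow_mul hk hx) y (mem_Icc_zero_one_of_pow_mul hk hy)
  | succ n ih =>
    have hk3 : k < 3 * 3 ^ n := by rwa [pow_succ'] at hk
    simp only [pow_succ, mem_Icc] at hx hy
    rw [triadicWeight]
    split_ifs with h₁ h₂
    · have hx' : 3 ^ n * (3 * x) ∈ Icc (k : ℝ) (k + 1) := ⟨by linarith, by linarith⟩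
      have hy' : 3 ^ n * (3 * y) ∈ Icc (k : ℝ) (k + 1) := ⟨by linarith, by linarith⟩
      have ex := (hF.2 _ (mem_Icc_zero_one_of_pow_mul h₁ hx')).1
      have ey := (hF.2 _ (mem_Icc_zero_one_of_pow_mul h₁ hy')).1
      rw [show 3 * x / 3 = x by ring] at ex
      rw [show 3 * y / 3 = y by ring] at ey
      have := mul_le_mul_of_nonneg_left (ih k h₁ _ _ hx' hy') (mul_nonneg zero_le_three ha)
      rw [ex, ey, ← mul_sub, abs_mul, abs_of_nonneg ha, pow_succ]
      linarith
    · have hj : 2 * 3 ^ n - 1 - k < 3 ^ n := by omega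
      have hcast : ((2 * 3 ^ n - 1 - k : ℕ) : ℝ) = 2 * 3 ^ n - 1 - k := by
        rw [eq_sub_iff_add_eq, eq_sub_iff_add_eq]
        exact_mod_cast (by omega : 2 * 3 ^ n - 1 - k + k + 1 = 2 * 3 ^ n)
      have hx' : 3 ^ n * (2 - 3 * x) ∈ Icc ((2 * 3 ^ n - 1 - k : ℕ) : ℝ)
          ((2 * 3 ^ n - 1 - k : ℕ) + 1) := by
        rw [hcast]; constructor <;> linarith
      have hy' : 3 ^ n * (2 - 3 * y) ∈ Icc ((2 * 3 ^ n - 1 - k : ℕ) : ℝ)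
          ((2 * 3 ^ n - 1 - k : ℕ) + 1) := by
        rw [hcast]; constructor <;> linarith
      have ex := (hF.2 _ (mem_Icc_zero_one_of_pow_mul hj hx')).2.1
      have ey := (hF.2 _ (mem_Icc_zero_one_of_pow_mul hj hy')).2.1
      rw [show (2 - (2 - 3 * x)) / 3 = x by ring] at ex
      rw [show (2 - (2 - 3 * y)) / 3 = y by ring] at ey
      have := mul_le_mul_of_nonneg_left (ih _ hj _ _ hx' hy')
        (mul_nonneg zero_le_three (abs_nonneg (2 * a - 1)))
      rw [ex, ey, add_sub_add_right_eq_sub, ← mul_sub, abs_mul, pow_succ]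
      linarith
    · have hj : k - 2 * 3 ^ n < 3 ^ n := by omega
      have hcast : ((k - 2 * 3 ^ n : ℕ) : ℝ) = k - 2 * 3 ^ n := by
        rw [eq_sub_iff_add_eq]
        exact_mod_cast (by omega : k - 2 * 3 ^ n + 2 * 3 ^ n = k)
      have hx' : 3 ^ n * (3 * x - 2) ∈ Icc ((k - 2 * 3 ^ n : ℕ) : ℝ)
          ((k - 2 * 3 ^ n : ℕ) + 1) := by
        rw [hcast]; constructor <;> linarith
      have hy' : 3 ^ n * (3 * y - 2) ∈ Icc ((k - 2 * 3 ^ n : ℕ) : ℝ)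
          ((k - 2 * 3 ^ n : ℕ) + 1) := by
        rw [hcast]; constructor <;> linarith
      have ex := (hF.2 _ (mem_Icc_zero_one_of_pow_mul hj hx')).2.2
      have ey := (hF.2 _ (mem_Icc_zero_one_of_pow_mul hj hy')).2.2
      rw [show (2 + (3 * x - 2)) / 3 = x by ring] at ex
      rw [show (2 + (3 * y - 2)) / 3 = y by ring] at ey
      have := mul_le_mul_of_nonneg_left (ih _ hj _ _ hx' hy') (mul_nonneg zero_le_three ha)
      rw [ex, ey, add_sub_add_right_eq_sub, ← mul_sub, abs_mul, abs_of_nonneg ha, pow_succ]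
      linarith

lemma exists_triadic_index (n : ℕ) {x : ℝ} (hx : x ∈ Icc (0 : ℝ) 1) :
    ∃ k : ℕ, k < 3 ^ n ∧ 3 ^ n * x ∈ Icc (k : ℝ) (k + 1) := by
  have h3 : (0 : ℝ) < 3 ^ n := by positivity
  rcases hx.2.eq_or_lt with rfl | h1
  · refine ⟨3 ^ n - 1, Nat.sub_lt (by positivity) one_pos, ?_⟩
    rw [Nat.cast_sub (Nat.one_le_pow _ _ (by norm_num))]
    constructor <;> simp
  · have h0 : 0 ≤ 3 ^ n * x := mul_nonneg h3.le hx.1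
    refine ⟨⌊3 ^ n * x⌋₊, ?_, Nat.floor_le h0, (Nat.lt_floor_add_one _).le⟩
    rw [Nat.floor_lt h0]
    push_cast
    nlinarith

/-- If every triadic interval of level `n` within one interval length of `x` has weight less than
`δ`, then `F` oscillates by at most `2 M δ / 3 ^ n` between `x` and a point less than `3 ^ (-n)` away. -/
lemma IsOkamoto.abs_sub_le_of_triadicWeight_lt {a M δ : ℝ} {F : ℝ → ℝ} (ha : 0 ≤ a)
    (hF : IsOkamoto a F)
    (hM : ∀ x ∈ Icc (0 : ℝ) 1, ∀ y ∈ Icc (0 : ℝ) 1, |F x - F y| ≤ M) {n : ℕ} {x y : ℝ}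
    (hx : x ∈ Icc (0 : ℝ) 1) (hy : y ∈ Icc (0 : ℝ) 1) (hxy : 3 ^ n * |y - x| < 1)
    (hδ : ∀ k : ℕ, k < 3 ^ n → 3 ^ n * x ∈ Icc (k - 1 : ℝ) (k + 2) →
      triadicWeight (3 * a) (3 * |2 * a - 1|) n k < δ) :
    |F y - F x| * 3 ^ n ≤ 2 * M * δ := by
  have hM0 : 0 ≤ M := (abs_nonneg _).trans (hM x hx x hx)
  have h3 : (0 : ℝ) < 3 ^ n := by positivity
  obtain ⟨k, hk, hxk⟩ := exists_triadic_index n hx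
  obtain ⟨l, hl, hyl⟩ := exists_triadic_index n hy
  have hd : |3 ^ n * y - 3 ^ n * x| < 1 := by rwa [← mul_sub, abs_mul, abs_of_pos h3]
  obtain ⟨hd₁, hd₂⟩ := abs_lt.1 hd
  have wk := hδ k hk ⟨by linarith [hxk.1], by linarith [hxk.2]⟩
  have wl := hδ l hl ⟨by linarith [hyl.1], by linarith [hyl.2]⟩
  have hkδ := mul_le_mul_of_nonneg_left wk.le hM0
  have hlδ := mul_le_mul_of_nonneg_left wl.le hM0
  have hosc := hF.abs_sub_le_triadicWeight ha hM n
  obtain ⟨z, hzk, hzl⟩ : ∃ z, 3 ^ n * z ∈ Icc (k : ℝ) (k + 1) ∧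
      3 ^ n * z ∈ Icc (l : ℝ) (l + 1) := by
    have hlk : (l : ℝ) ≤ k + 1 := by
      have : (l : ℝ) < k + 2 := by linarith [hyl.1, hxk.2]
      have : l < k + 2 := by exact_mod_cast this
      exact_mod_cast (by omega : l ≤ k + 1)
    have hkl : (k : ℝ) ≤ l + 1 := by
      have : (k : ℝ) < l + 2 := by linarith [hxk.1, hyl.2]
      have : k < l + 2 := by exact_mod_cast this
      exact_mod_cast (by omega : k ≤ l + 1)
    refine ⟨max (k : ℝ) l / 3 ^ n, ?_⟩
    rw [mul_div_cancel₀ _ h3.ne']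
    exact ⟨⟨le_max_left _ _, max_le (by linarith) hlk⟩, ⟨le_max_right _ _, max_le hkl (by linarith)⟩⟩
  have hz₁ := hosc k hk z x hzk hxk
  have hz₂ := hosc l hl y z hyl hzl
  have := mul_le_mul_of_nonneg_right (abs_sub_le (F y) (F z) (F x)) h3.le
  linarith

lemma ae_eventually_triadicWeight_lt {p q : ℝ} (hp : 0 < p) (hq : 0 ≤ q) (h : p ^ 2 * q < 1) :
    ∀ᵐ x : ℝ, ∀ δ : ℝ, 0 < δ → ∀ᶠ n in atTop, ∀ k : ℕ, k < 3 ^ n →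
      3 ^ n * x ∈ Icc (k - 1 : ℝ) (k + 2) → triadicWeight p q n k < δ := by
  obtain ⟨s, hs, hlt⟩ := exists_pos_rpow_add_lt_three hp hq h
  have hw := triadicWeight_nonneg hp.le hq
  let S : ℕ → ℕ → Set ℝ := fun n k => Icc ((k - 1 : ℝ) / 3 ^ n) ((k + 2) / 3 ^ n)
  let c : ℕ → ℕ → ENNReal := fun n k => ENNReal.ofReal (triadicWeight p q n k ^ s)
  let g : ℕ → ℝ → ENNReal := fun n x =>
    ∑ k ∈ Finset.range (3 ^ n), (S n k).indicator (fun _ => c n k) x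
  have hgm : ∀ n, Measurable (g n) := fun n =>
    Finset.measurable_fun_sum _ fun k _ => measurable_const.indicator measurableSet_Icc
  have hg : ∀ n, ∫⁻ x, g n x = ENNReal.ofReal (3 * ((2 * p ^ s + q ^ s) / 3) ^ n) := by
    intro n
    have hint : ∀ k, ∫⁻ x, (S n k).indicator (fun _ => c n k) x =
        c n k * ENNReal.ofReal (3 / 3 ^ n) := fun k => by
      rw [lintegral_indicator_const measurableSet_Icc, Real.volume_Icc]
      congr 2
      ring
    rw [lintegral_finsetSum _ fun k _ => measurable_const.indicator measurableSet_Icc]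
    rw [Finset.sum_congr rfl fun k _ => hint k, ← Finset.sum_mul,
      ← ENNReal.ofReal_sum_of_nonneg fun k _ => Real.rpow_nonneg (hw n k) s,
      sum_triadicWeight_rpow hp.le hq, ← ENNReal.ofReal_mul (by positivity)]
    congr 1
    rw [div_pow]
    ring
  have hsum : ∫⁻ x, ∑' n, g n x ≠ ⊤ := by
    rw [lintegral_tsum fun n => (hgm n).aemeasurable]
    simp_rw [hg]
    refine Summable.tsum_ofReal_ne_top (Summable.mul_left _ ?_)
    exact summable_geometric_of_lt_one (by positivity) (by linarith)
  filter_upwards [ae_lt_top (Measurable.tsum hgm) hsum] with x hx δ hδ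
  have hlim := ENNReal.tendsto_atTop_zero_of_tsum_ne_top hx.ne
  filter_upwards [hlim.eventually
    (gt_mem_nhds (ENNReal.ofReal_pos.2 (Real.rpow_pos_of_pos hδ s)))] with n hn k hk hxk
  have hxS : x ∈ S n k := by
    have h3 : (0 : ℝ) < 3 ^ n := by positivity
    exact ⟨(div_le_iff₀' h3).2 hxk.1, (le_div_iff₀' h3).2 hxk.2⟩
  have hle : c n k ≤ g n x := by
    have := Finset.single_le_sum (f := fun k => (S n k).indicator (fun _ => c n k) x)
      (fun _ _ => zero_le) (Finset.mem_range.2 hk)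
    simpa only [indicator_of_mem hxS] using this
  have := (ENNReal.ofReal_lt_ofReal_iff (Real.rpow_pos_of_pos hδ s)).1 (hle.trans_lt hn)
  exact (Real.rpow_lt_rpow_iff (hw n k) hδ.le hs).1 this

/-- For every `a ∈ (0,1/3) ∪ (1/3,a₀)`, the Okamoto function with parameter `a` has
derivative 0 within `[0,1]` at Lebesgue-almost every `x ∈ [0,1]`. -/
theorem okamoto_ae_deriv_zero (a₀ : ℝ) (ha₀ : a₀ ∈ Set.Ioo (1 / 2 : ℝ) (2 / 3))
    (hroot : 27 * a₀ ^ 2 - 54 * a₀ ^ 3 = -1)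
    (a : ℝ) (ha : a ∈ Set.Ioo (0 : ℝ) (1 / 3) ∪ Set.Ioo (1 / 3 : ℝ) a₀)
    (F : ℝ → ℝ) (hF : IsOkamoto a F) :
    ∀ᵐ x ∂(volume.restrict (Set.Icc (0 : ℝ) 1)),
      HasDerivWithinAt F 0 (Set.Icc 0 1) x := by
  obtain ⟨C, hC⟩ := isCompact_Icc.exists_bound_of_continuousOn hF.1
  have hM : ∀ x ∈ Icc (0 : ℝ) 1, ∀ y ∈ Icc (0 : ℝ) 1, |F x - F y| ≤ 2 * C := fun x hx y hy => by
    linarith [norm_sub_le (F x) (F y), hC x hx, hC y hy, Real.norm_eq_abs (F x - F y)]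
  have ha0 : 0 < a := by
    rcases ha with ha | ha <;> linarith [ha.1]
  rw [ae_restrict_iff' measurableSet_Icc]
  filter_upwards [ae_eventually_triadicWeight_lt (mul_pos three_pos ha0)
    (mul_nonneg zero_le_three (abs_nonneg _)) (sq_mul_abs_lt_one ha₀ hroot ha)] with x hx hx01
  have hC0 : 0 ≤ C := (norm_nonneg _).trans (hC x hx01)
  rw [hasDerivWithinAt_iff_isLittleO, Asymptotics.isLittleO_iff]
  intro ε hε
  obtain ⟨δ, hδ, hδε⟩ : ∃ δ > 0, 6 * (2 * (2 * C) * δ) ≤ ε := by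
    refine ⟨ε / (24 * (C + 1)), by positivity, ?_⟩
    have : 6 * (2 * (2 * C) * (ε / (24 * (C + 1)))) = ε * (C / (C + 1)) := by
      field_simp
      ring
    rw [this]
    exact mul_le_of_le_one_right hε.le (div_le_one_of_le₀ (by linarith) (by linarith))
  obtain ⟨N, hN⟩ := eventually_atTop.1 (hx δ hδ)
  have hball : Metric.ball x (1 / (2 * 3 ^ N)) ∈ nhds x := Metric.ball_mem_nhds x (by positivity)
  filter_upwards [self_mem_nhdsWithin, mem_nhdsWithin_of_mem_nhds hball] with y hy hyx
  rw [smul_zero, sub_zero, Real.norm_eq_abs, Real.norm_eq_abs]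
  rcases eq_or_ne y x with rfl | hne
  · simp
  have hd : 0 < |y - x| := abs_pos.2 (sub_ne_zero.2 hne)
  rw [Metric.mem_ball, Real.dist_eq, lt_div_iff₀ (by positivity)] at hyx
  have hNd : (3 : ℝ) ^ N < 1 / (2 * |y - x|) := by
    rw [lt_div_iff₀ (by positivity)]
    linarith
  have h1N : (1 : ℝ) ≤ 3 ^ N := one_le_pow₀ (by norm_num)
  obtain ⟨n, hn, hn'⟩ := exists_nat_pow_near (h1N.trans hNd.le) (by norm_num : (1 : ℝ) < 3)
  have hNn : N ≤ n := Nat.lt_succ_iff.1 <|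
    (pow_lt_pow_iff_right₀ (by norm_num : (1 : ℝ) < 3)).1 (hNd.trans hn')
  rw [le_div_iff₀ (by positivity)] at hn
  rw [div_lt_iff₀ (by positivity), pow_succ] at hn'
  have hosc := hF.abs_sub_le_of_triadicWeight_lt ha0.le hM hx01 hy (by linarith) (hN n hNn)
  have h3 : (0 : ℝ) < 3 ^ n := by positivity
  have hscale : 2 * (2 * C) * δ * 1 ≤ 2 * (2 * C) * δ * (3 ^ n * 3 * (2 * |y - x|)) :=
    mul_le_mul_of_nonneg_left hn'.le (by positivity)
  have hε' := mul_le_mul_of_nonneg_right hδε (mul_pos h3 hd).le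
  refine le_of_mul_le_mul_right ?_ h3
  linarith
end

section
/- Let a₀ ∈ (1/2, 2/3) satisfy 27a₀² − 54a₀³ = −1. For every a ∈ (0, 1/3) ∪ (1/3, 1/2) ∪ (1/2, a₀) and every Okamoto function F with parameter a, there is no point x ∈ (0,1) such that F is differentiable at every point of some open neighborhood of x contained in (0,1); in particular, there is no point of (0,1) at which F is twice differentiable. -/
open Set MeasureTheory Filter

/-- If the difference quotients of `F` at `p` along the sequence `p + u * q ^ n` (which tends
to `p`) grow geometrically, then `F` is not differentiable at `p`. -/
theorem not_differentiableAt_of_geometric_slope {F : ℝ → ℝ} {p u q C r : ℝ}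
    (hu : u ≠ 0) (hq0 : q ≠ 0) (hq1 : |q| < 1) (hC : 0 < C) (hr : 1 < r)
    (h : ∀ n : ℕ, F (p + u * q ^ n) - F p = C * r ^ n * (u * q ^ n)) :
    ¬ DifferentiableAt ℝ F p := by
  intro hd
  have hne : ∀ n : ℕ, u * q ^ n ≠ 0 := fun n => mul_ne_zero hu (pow_ne_zero n hq0)
  have hlim : Tendsto (fun n : ℕ => p + u * q ^ n) atTop (nhdsWithin p {p}ᶜ) := by
    refine tendsto_nhdsWithin_iff.2 ⟨?_, Eventually.of_forall fun n => ?_⟩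
    · simpa using ((tendsto_pow_atTop_nhds_zero_of_abs_lt_one hq1).const_mul u).const_add p
    · simpa using ⟨hu, fun h0 => absurd h0 hq0⟩
  have hslope := (hasDerivAt_iff_tendsto_slope.1 hd.hasDerivAt).comp hlim
  refine not_tendsto_nhds_of_tendsto_atTop
    ((tendsto_pow_atTop_atTop_of_one_lt hr).const_mul_atTop hC) (deriv F p)
    (hslope.congr fun n => ?_)
  rw [Function.comp_apply, slope_def_field, h n, add_sub_cancel_left,
    mul_div_cancel_right₀ _ (hne n)]

/-- Differentiability pulls back along a relation `F (α * x + β) = c * F x + d` with `c ≠ 0`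
that holds on a neighbourhood of the point. -/
theorem DifferentiableAt.of_selfAffine {F : ℝ → ℝ} {s : Set ℝ} {α β c d x : ℝ}
    (hs : s ∈ nhds x) (hc : c ≠ 0) (h : ∀ y ∈ s, F (α * y + β) = c * F y + d)
    (hd : DifferentiableAt ℝ F (α * x + β)) : DifferentiableAt ℝ F x := by
  have h1 : DifferentiableAt ℝ (fun y => (F (α * y + β) - d) / c) x :=
    ((DifferentiableAt.fun_comp' x hd (by fun_prop)).sub_const d).div_const c
  refine h1.congr_of_eventuallyEq ?_
  filter_upwards [hs] with y hy
  rw [h y hy]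
  field_simp
  ring

/-- A nonempty subset of `[0,1]` that is invariant under the three contractions
`x / 3`, `(2 - x) / 3`, `(2 + x) / 3` meets every ball of radius `3⁻ⁿ` about a point of
`[0,1]`. -/
theorem exists_abs_sub_le_of_invariant {N : Set ℝ} (hN : N ⊆ Icc 0 1) (hne : N.Nonempty)
    (h₁ : ∀ x ∈ N, x / 3 ∈ N) (h₂ : ∀ x ∈ N, (2 - x) / 3 ∈ N) (h₃ : ∀ x ∈ N, (2 + x) / 3 ∈ N)
    (n : ℕ) : ∀ x ∈ Icc (0 : ℝ) 1, ∃ y ∈ N, |x - y| ≤ (1 / 3 : ℝ) ^ n := by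
  induction n with
  | zero =>
    rintro x ⟨hx0, hx1⟩
    obtain ⟨y, hy⟩ := hne
    obtain ⟨hy0, hy1⟩ := hN hy
    refine ⟨y, hy, ?_⟩
    rw [pow_zero, abs_le]
    constructor <;> linarith
  | succ n ih =>
    rintro x ⟨hx0, hx1⟩
    rcases le_total x (1 / 3) with h | h
    · obtain ⟨y, hy, hxy⟩ := ih (3 * x) ⟨by linarith, by linarith⟩
      refine ⟨y / 3, h₁ y hy, ?_⟩
      rw [abs_le] at hxy ⊢
      rw [pow_succ]
      constructor <;> linarith
    rcases le_total x (2 / 3) with h' | h'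
    · obtain ⟨y, hy, hxy⟩ := ih (2 - 3 * x) ⟨by linarith, by linarith⟩
      refine ⟨(2 - y) / 3, h₂ y hy, ?_⟩
      rw [abs_le] at hxy ⊢
      rw [pow_succ]
      constructor <;> linarith
    · obtain ⟨y, hy, hxy⟩ := ih (3 * x - 2) ⟨by linarith, by linarith⟩
      refine ⟨(2 + y) / 3, h₃ y hy, ?_⟩
      rw [abs_le] at hxy ⊢
      rw [pow_succ]
      constructor <;> linarith

namespace IsOkamoto

variable {a : ℝ} {F : ℝ → ℝ}

theorem apply_one (hF : IsOkamoto a F) (ha : a < 1) : F 1 = 1 := by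
  have h := (hF.2 1 (by norm_num)).2.2
  norm_num at h
  have : (1 - a) * (F 1 - 1) = 0 := by linarith
  rcases mul_eq_zero.1 this with h | h <;> linarith

theorem apply_half (hF : IsOkamoto a F) (ha : a < 1) : F (1 / 2) = 1 / 2 := by
  have h := (hF.2 (1 / 2) (by norm_num)).2.1
  rw [show ((2 : ℝ) - 1 / 2) / 3 = 1 / 2 by norm_num] at h
  have : (1 - a) * (F (1 / 2) - 1 / 2) = 0 := by linarith
  rcases mul_eq_zero.1 this with h | h <;> linarith

theorem apply_one_sub_pow (hF : IsOkamoto a F) (ha : a < 1) (n : ℕ) :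
    F (1 - (1 / 3) ^ n) = 1 - a ^ n := by
  induction n with
  | zero =>
    have h := (hF.2 0 (by norm_num)).1
    norm_num at h ⊢
    have : (1 - a) * F 0 = 0 := by linarith
    rcases mul_eq_zero.1 this with h | h <;> linarith
  | succ n ih =>
    have h0 : (0 : ℝ) ≤ (1 / 3) ^ n := by positivity
    have h1 : (1 / 3 : ℝ) ^ n ≤ 1 := pow_le_one₀ (by norm_num) (by norm_num)
    have h := (hF.2 (1 - (1 / 3) ^ n) ⟨by linarith, by linarith⟩).2.2
    rw [ih] at h
    rw [show (1 : ℝ) - (1 / 3) ^ (n + 1) = (2 + (1 - (1 / 3) ^ n)) / 3 by ring, h]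
    ring

theorem apply_half_add_pow (hF : IsOkamoto a F) (ha : a < 1) (n : ℕ) :
    F (1 / 2 + 1 / 2 * (-1 / 3) ^ n) = 1 / 2 + 1 / 2 * (2 * a - 1) ^ n := by
  induction n with
  | zero => norm_num [hF.apply_one ha]
  | succ n ih =>
    have h1 : |(-1 / 3 : ℝ) ^ n| ≤ 1 := by
      rw [abs_pow]
      exact pow_le_one₀ (abs_nonneg _) (by norm_num [abs_le])
    rw [abs_le] at h1
    have h := (hF.2 (1 / 2 + 1 / 2 * (-1 / 3) ^ n) ⟨by linarith, by linarith⟩).2.1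
    rw [ih] at h
    rw [show (1 / 2 + 1 / 2 * (-1 / 3) ^ (n + 1) : ℝ)
      = (2 - (1 / 2 + 1 / 2 * (-1 / 3) ^ n)) / 3 by ring, h]
    ring

theorem not_differentiableAt_third (hF : IsOkamoto a F) (ha : 1 / 3 < a) (ha' : a < 1) :
    ¬ DifferentiableAt ℝ F (1 / 3) := by
  refine not_differentiableAt_of_geometric_slope (u := -1 / 3) (q := 1 / 3) (C := 3 * a)
    (r := 3 * a) (by norm_num) (by norm_num) (by norm_num [abs_lt]) (by linarith)
    (by linarith) fun n => ?_
  have h0 : (0 : ℝ) ≤ (1 / 3) ^ n := by positivity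
  have h1 : (1 / 3 : ℝ) ^ n ≤ 1 := pow_le_one₀ (by norm_num) (by norm_num)
  rw [show (1 / 3 + -1 / 3 * (1 / 3) ^ n : ℝ) = (1 - (1 / 3) ^ n) / 3 by ring,
    (hF.2 (1 - (1 / 3) ^ n) ⟨by linarith, by linarith⟩).1, (hF.2 1 (by norm_num)).1,
    hF.apply_one_sub_pow ha', hF.apply_one ha', mul_pow]
  have h3 : (3 : ℝ) ^ n * (1 / 3) ^ n = 1 := by rw [← mul_pow]; norm_num
  linear_combination a * a ^ n * h3

theorem not_differentiableAt_half (hF : IsOkamoto a F) (ha : a < 1 / 3) :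
    ¬ DifferentiableAt ℝ F (1 / 2) := by
  refine not_differentiableAt_of_geometric_slope (u := 1 / 2) (q := -1 / 3) (C := 1)
    (r := -3 * (2 * a - 1)) (by norm_num) (by norm_num) (by norm_num [abs_lt]) one_pos
    (by linarith) fun n => ?_
  rw [hF.apply_half_add_pow (by linarith), hF.apply_half (by linarith), mul_pow]
  have h3 : (-3 : ℝ) ^ n * (-1 / 3) ^ n = 1 := by rw [← mul_pow]; norm_num
  linear_combination -(1 / 2) * (2 * a - 1) ^ n * h3

/-- Points of non-differentiability come arbitrarily close to every point of `[0,1]`. -/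
theorem exists_not_differentiableAt (hF : IsOkamoto a F) (ha0 : a ≠ 0) (ha1 : a < 1)
    (ha2 : a ≠ 1 / 2) (ha3 : a ≠ 1 / 3) (n : ℕ) {x : ℝ} (hx : x ∈ Icc (0 : ℝ) 1) :
    ∃ y, ¬ DifferentiableAt ℝ F y ∧ |x - y| ≤ (1 / 3 : ℝ) ^ n := by
  have hnhds : ∀ y ∈ Ioo (0 : ℝ) 1, Icc (0 : ℝ) 1 ∈ nhds y := fun y hy => Icc_mem_nhds hy.1 hy.2
  have hc : 2 * a - 1 ≠ 0 := fun h => ha2 (by linarith)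
  suffices h : ∃ y ∈ {y | y ∈ Ioo (0 : ℝ) 1 ∧ ¬ DifferentiableAt ℝ F y},
      |x - y| ≤ (1 / 3 : ℝ) ^ n by
    obtain ⟨y, hy, hxy⟩ := h
    exact ⟨y, hy.2, hxy⟩
  refine exists_abs_sub_le_of_invariant (fun y hy => Ioo_subset_Icc_self hy.1)
    ?_ ?_ ?_ ?_ n x hx
  · rcases lt_or_gt_of_ne ha3 with h | h
    · exact ⟨1 / 2, by norm_num, hF.not_differentiableAt_half h⟩
    · exact ⟨1 / 3, by norm_num, hF.not_differentiableAt_third h ha1⟩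
  · rintro y ⟨hy, hnd⟩
    refine ⟨⟨by linarith [hy.1], by linarith [hy.2]⟩, fun hd => hnd ?_⟩
    refine DifferentiableAt.of_selfAffine (α := 1 / 3) (β := 0) (d := 0) (hnhds y hy) ha0
      (fun z hz => ?_) (by convert hd using 1; ring)
    rw [show 1 / 3 * z + 0 = z / 3 by ring, (hF.2 z hz).1, add_zero]
  · rintro y ⟨hy, hnd⟩
    refine ⟨⟨by linarith [hy.2], by linarith [hy.1]⟩, fun hd => hnd ?_⟩
    refine DifferentiableAt.of_selfAffine (α := -1 / 3) (β := 2 / 3) (d := 1 - a) (hnhds y hy) hc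
      (fun z hz => ?_) (by convert hd using 1; ring)
    rw [show -1 / 3 * z + 2 / 3 = (2 - z) / 3 by ring, (hF.2 z hz).2.1]
  · rintro y ⟨hy, hnd⟩
    refine ⟨⟨by linarith [hy.1], by linarith [hy.2]⟩, fun hd => hnd ?_⟩
    refine DifferentiableAt.of_selfAffine (α := 1 / 3) (β := 2 / 3) (d := 1 - a) (hnhds y hy) ha0
      (fun z hz => ?_) (by convert hd using 1; ring)
    rw [show 1 / 3 * z + 2 / 3 = (2 + z) / 3 by ring, (hF.2 z hz).2.2]

end IsOkamoto

/-- For every `a ∈ (0,1/3) ∪ (1/3,1/2) ∪ (1/2,a₀)`, there is no point of `(0,1)` having an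
open neighborhood inside `(0,1)` on which the Okamoto function with parameter `a` is
differentiable; in particular there is no point of `(0,1)` at which it is twice
differentiable. -/
theorem okamoto_no_nbhd_differentiable (a₀ : ℝ) (ha₀ : a₀ ∈ Set.Ioo (1 / 2 : ℝ) (2 / 3))
    (hroot : 27 * a₀ ^ 2 - 54 * a₀ ^ 3 = -1)
    (a : ℝ)
    (ha : a ∈ Set.Ioo (0 : ℝ) (1 / 3) ∪ Set.Ioo (1 / 3 : ℝ) (1 / 2) ∪ Set.Ioo (1 / 2 : ℝ) a₀)
    (F : ℝ → ℝ) (hF : IsOkamoto a F) :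
    (¬ ∃ x ∈ Set.Ioo (0 : ℝ) 1, ∃ U : Set ℝ, IsOpen U ∧ x ∈ U ∧ U ⊆ Set.Ioo 0 1 ∧
        ∀ y ∈ U, DifferentiableAt ℝ F y) ∧
    (¬ ∃ x ∈ Set.Ioo (0 : ℝ) 1, ∃ U : Set ℝ, IsOpen U ∧ x ∈ U ∧ U ⊆ Set.Ioo 0 1 ∧
        (∀ y ∈ U, DifferentiableAt ℝ F y) ∧ DifferentiableAt ℝ (deriv F) x) := by
  have ha' : a ≠ 0 ∧ a < 1 ∧ a ≠ 1 / 2 ∧ a ≠ 1 / 3 := by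
    have := ha₀.2
    rcases ha with (⟨h, h'⟩ | ⟨h, h'⟩) | ⟨h, h'⟩ <;>
      refine ⟨?_, by linarith, ?_, ?_⟩ <;> intro <;> linarith
  obtain ⟨ha0, ha1, ha2, ha3⟩ := ha'
  have key : ¬ ∃ x ∈ Set.Ioo (0 : ℝ) 1, ∃ U : Set ℝ, IsOpen U ∧ x ∈ U ∧ U ⊆ Set.Ioo 0 1 ∧
      ∀ y ∈ U, DifferentiableAt ℝ F y := by
    rintro ⟨x, hx, U, hU, hxU, -, hd⟩
    obtain ⟨ε, hε, hball⟩ := Metric.isOpen_iff.1 hU x hxU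
    obtain ⟨n, hn⟩ := exists_pow_lt_of_lt_one hε (by norm_num : (1 / 3 : ℝ) < 1)
    obtain ⟨y, hy, hxy⟩ :=
      hF.exists_not_differentiableAt ha0 ha1 ha2 ha3 n (Ioo_subset_Icc_self hx)
    refine hy (hd y (hball ?_))
    rw [Metric.mem_ball, dist_comm, Real.dist_eq]
    exact hxy.trans_lt hn
  exact ⟨key, fun ⟨x, hx, U, hU, hxU, hsub, hd, _⟩ => key ⟨x, hx, U, hU, hxU, hsub, hd⟩⟩
end

section
/- For every a ∈ (0, 1/2] and every Okamoto function F with parameter a, F is nondecreasing on [0,1]. -/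
open Set MeasureTheory Filter

/-- Every point of `[0,1]` lies in the image of one of the three contractions
`u ↦ u / 3`, `u ↦ (2 - u) / 3`, `u ↦ (2 + u) / 3`. -/
theorem exists_eq_third_of_mem_Icc {x : ℝ} (hx : x ∈ Set.Icc (0 : ℝ) 1) :
    ∃ u ∈ Set.Icc (0 : ℝ) 1, x = u / 3 ∨ x = (2 - u) / 3 ∨ x = (2 + u) / 3 := by
  obtain ⟨h0, h1⟩ := hx
  rcases le_total x (1 / 3) with h | h
  · exact ⟨3 * x, ⟨by linarith, by linarith⟩, Or.inl (by ring)⟩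
  rcases le_total x (2 / 3) with h' | h'
  · exact ⟨2 - 3 * x, ⟨by linarith, by linarith⟩, Or.inr (Or.inl (by ring))⟩
  · exact ⟨3 * x - 2, ⟨by linarith, by linarith⟩, Or.inr (Or.inr (by ring))⟩

/-- An Okamoto function with parameter in `(0,1/2]` takes its values in `[0,1]`. -/
theorem IsOkamoto.mapsTo {a : ℝ} {F : ℝ → ℝ} (hF : IsOkamoto a F)
    (ha : a ∈ Set.Ioc (0 : ℝ) (1 / 2)) :
    Set.MapsTo F (Set.Icc 0 1) (Set.Icc 0 1) := by
  obtain ⟨hc, hE⟩ := hF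
  obtain ⟨ha0, ha1⟩ := ha
  obtain ⟨x, hx, hmax⟩ := isCompact_Icc.exists_isMaxOn
    (Set.nonempty_Icc.2 (zero_le_one (α := ℝ))) (hc.sub continuousOn_const).abs
  have hK : ∀ y ∈ Set.Icc (0 : ℝ) 1, |F y - 1 / 2| ≤ |F x - 1 / 2| := fun y hy => hmax hy
  suffices h : |F x - 1 / 2| ≤ 1 / 2 by
    intro y hy
    obtain ⟨h1, h2⟩ := abs_le.1 ((hK y hy).trans h)
    exact ⟨by linarith, by linarith⟩
  by_contra! hlt
  obtain ⟨u, hu, hxu⟩ := exists_eq_third_of_mem_Icc hx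
  obtain ⟨e1, e2, e3⟩ := hE u hu
  obtain ⟨b1, b2⟩ := abs_le.1 (hK u hu)
  generalize hk : |F x - 1 / 2| = K at *
  have key : |F x - 1 / 2| < K := by
    rw [abs_lt]
    rcases hxu with h | h | h
    · rw [h, e1]; constructor <;> nlinarith
    · rw [h, e2]; constructor <;> nlinarith
    · rw [h, e3]; constructor <;> nlinarith
  exact key.ne hk

/-- For every `a ∈ (0,1/2]`, the Okamoto function with parameter `a` is nondecreasing
on `[0,1]`. -/
theorem okamoto_monotoneOn (a : ℝ) (ha : a ∈ Set.Ioc (0 : ℝ) (1 / 2))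
    (F : ℝ → ℝ) (hF : IsOkamoto a F) :
    MonotoneOn F (Set.Icc 0 1) := by
  have hR := hF.mapsTo ha
  obtain ⟨hc, hE⟩ := hF
  obtain ⟨ha0, ha1⟩ := ha
  set S : Set (ℝ × ℝ) := (Set.Icc 0 1 ×ˢ Set.Icc 0 1) ∩ {p | p.1 ≤ p.2}
  have hS : IsCompact S :=
    (isCompact_Icc.prod isCompact_Icc).inter_right (isClosed_le continuous_fst continuous_snd)
  have hS0 : S.Nonempty := ⟨(0, 0), by simp [S]⟩
  have hcont : ContinuousOn (fun p : ℝ × ℝ => F p.1 - F p.2) S :=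
    (hc.comp continuousOn_fst fun p hp => hp.1.1).sub
      (hc.comp continuousOn_snd fun p hp => hp.1.2)
  obtain ⟨⟨x, y⟩, ⟨⟨hx, hy⟩, hxy⟩, hmax⟩ := hS.exists_isMaxOn hS0 hcont
  replace hx : x ∈ Set.Icc (0 : ℝ) 1 := hx
  replace hy : y ∈ Set.Icc (0 : ℝ) 1 := hy
  have hM : ∀ u ∈ Set.Icc (0 : ℝ) 1, ∀ v ∈ Set.Icc (0 : ℝ) 1, u ≤ v →
      F u - F v ≤ F x - F y := fun u hu v hv huv =>
    hmax (show (u, v) ∈ S from ⟨⟨hu, hv⟩, huv⟩)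
  suffices h : F x - F y ≤ 0 from fun u hu v hv huv => by linarith [hM u hu v hv huv]
  by_contra! hpos
  have hlt : x < y := lt_of_le_of_ne hxy fun h => by simp [h] at hpos
  obtain ⟨u, hu, hxu⟩ := exists_eq_third_of_mem_Icc hx
  obtain ⟨v, hv, hyv⟩ := exists_eq_third_of_mem_Icc hy
  obtain ⟨eu1, eu2, eu3⟩ := hE u hu
  obtain ⟨ev1, ev2, ev3⟩ := hE v hv
  have huv := hM u hu v hv
  have hvu := hM v hv u hu
  obtain ⟨ru0, ru1⟩ := hR hu
  obtain ⟨rv0, rv1⟩ := hR hv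
  obtain ⟨hu0, hu1⟩ := hu
  obtain ⟨hv0, hv1⟩ := hv
  rcases hxu with hxu | hxu | hxu <;> rcases hyv with hyv | hyv | hyv
  · have := huv (by linarith)
    rw [hxu, hyv, eu1, ev1] at this hpos
    nlinarith
  · rw [hxu, hyv, eu1, ev2] at hpos
    nlinarith
  · rw [hxu, hyv, eu1, ev3] at hpos
    nlinarith
  · linarith
  · have := hvu (by linarith)
    rw [hxu, hyv, eu2, ev2] at this hpos
    nlinarith
  · rw [hxu, hyv, eu2, ev3] at hpos
    nlinarith
  · linarith
  · linarith
  · have := huv (by linarith)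
    rw [hxu, hyv, eu3, ev3] at this hpos
    nlinarith
end

section
/- For every a ∈ (0, 1/2] and every Okamoto function F with parameter a, the Hausdorff dimension of the graph Γ_F = {(x, F(x)) : x ∈ [0,1]} ⊆ ℝ² equals 1. -/
open Set MeasureTheory Filter

/-- The graph of `F` over `[0,1]`, as a subset of the Euclidean plane. -/
noncomputable def graphE (F : ℝ → ℝ) : Set (EuclideanSpace ℝ (Fin 2)) :=
  (fun x : ℝ => (WithLp.equiv 2 (Fin 2 → ℝ)).symm ![x, F x]) '' Set.Icc 0 1

/-- Every point of `[0,1]` is the image of a point of `[0,1]` under one of the three contractions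
`x ↦ x / 3`, `x ↦ (2 - x) / 3`, `x ↦ (2 + x) / 3`. -/
theorem exists_eq_third {x : ℝ} (hx : x ∈ Icc (0 : ℝ) 1) :
    ∃ t ∈ Icc (0 : ℝ) 1, x = t / 3 ∨ x = (2 - t) / 3 ∨ x = (2 + t) / 3 := by
  obtain ⟨h0, h1⟩ := hx
  rcases le_total x (1 / 3) with h | h
  · exact ⟨3 * x, ⟨by linarith, by linarith⟩, Or.inl (by ring)⟩
  rcases le_total x (2 / 3) with h' | h'
  · exact ⟨2 - 3 * x, ⟨by linarith, by linarith⟩, Or.inr (Or.inl (by ring))⟩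
  · exact ⟨3 * x - 2, ⟨by linarith, by linarith⟩, Or.inr (Or.inr (by ring))⟩

/-- An Okamoto function with parameter `a ∈ (0,1/2]` takes values in `[0,1]`. -/
theorem IsOkamoto.mapsTo_Icc {a : ℝ} {F : ℝ → ℝ} (hF : IsOkamoto a F)
    (ha : a ∈ Ioc (0 : ℝ) (1 / 2)) : MapsTo F (Icc 0 1) (Icc 0 1) := by
  obtain ⟨hc, hf⟩ := hF
  obtain ⟨ha0, ha1⟩ := ha
  obtain ⟨x, hx, hmax⟩ := isCompact_Icc.exists_isMaxOn (nonempty_Icc.2 zero_le_one)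
    ((hc.sub continuousOn_const).abs : ContinuousOn (fun x => |F x - 1 / 2|) (Icc 0 1))
  have hD : ∀ y ∈ Icc (0 : ℝ) 1, |F y - 1 / 2| ≤ |F x - 1 / 2| := fun y hy => hmax hy
  have key : |F x - 1 / 2| ≤ 1 / 2 := by
    obtain ⟨t, ht, hxt⟩ := exists_eq_third hx
    obtain ⟨h1, h2, h3⟩ := hf t ht
    obtain ⟨hl, hu⟩ := abs_le.1 (hD t ht)
    have hD0 : 0 ≤ |F x - 1 / 2| := abs_nonneg _
    generalize hDdef : |F x - 1 / 2| = D at hl hu hD0 ⊢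
    by_contra! hlt
    rcases hxt with h | h | h
    · have : D ≤ a * D + (1 - a) / 2 := by
        refine hDdef.ge.trans ?_
        rw [h, h1, abs_le]
        constructor <;> nlinarith
      nlinarith
    · have : D ≤ (1 - 2 * a) * D := by
        refine hDdef.ge.trans ?_
        rw [h, h2, abs_le]
        constructor <;> nlinarith
      nlinarith
    · have : D ≤ a * D + (1 - a) / 2 := by
        refine hDdef.ge.trans ?_
        rw [h, h3, abs_le]
        constructor <;> nlinarith
      nlinarith
  intro y hy
  obtain ⟨hl, hu⟩ := abs_le.1 ((hD y hy).trans key)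
  exact ⟨by linarith, by linarith⟩

/-- An Okamoto function with parameter `a ∈ (0,1/2]` is nondecreasing on `[0,1]`. -/
theorem IsOkamoto.monotoneOn {a : ℝ} {F : ℝ → ℝ} (hF : IsOkamoto a F)
    (ha : a ∈ Ioc (0 : ℝ) (1 / 2)) : MonotoneOn F (Icc 0 1) := by
  have hmaps := hF.mapsTo_Icc ha
  obtain ⟨hc, hf⟩ := hF
  obtain ⟨ha0, ha1⟩ := ha
  have hK : IsCompact ((Icc (0 : ℝ) 1 ×ˢ Icc (0 : ℝ) 1) ∩ {p : ℝ × ℝ | p.1 ≤ p.2}) :=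
    (isCompact_Icc.prod isCompact_Icc).inter_right (isClosed_le continuous_fst continuous_snd)
  have hcont : ContinuousOn (fun p : ℝ × ℝ => F p.1 - F p.2)
      ((Icc (0 : ℝ) 1 ×ˢ Icc (0 : ℝ) 1) ∩ {p : ℝ × ℝ | p.1 ≤ p.2}) :=
    (hc.comp continuousOn_fst fun p hp => hp.1.1).sub
      (hc.comp continuousOn_snd fun p hp => hp.1.2)
  obtain ⟨⟨x, y⟩, ⟨⟨hx, hy⟩, hxy⟩, hmax⟩ := hK.exists_isMaxOn
    ⟨(0, 0), ⟨⟨by simp, by simp⟩, le_refl (0 : ℝ)⟩⟩ hcont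
  have hM : ∀ s ∈ Icc (0 : ℝ) 1, ∀ t ∈ Icc (0 : ℝ) 1, s ≤ t → F s - F t ≤ F x - F y :=
    fun s hs t ht hst => hmax (a := (s, t)) ⟨⟨hs, ht⟩, hst⟩
  replace hxy : x ≤ y := hxy
  replace hx : x ∈ Icc (0 : ℝ) 1 := hx
  replace hy : y ∈ Icc (0 : ℝ) 1 := hy
  have key : F x - F y ≤ 0 := by
    obtain ⟨s, hs, hxs⟩ := exists_eq_third hx
    obtain ⟨t, ht, hyt⟩ := exists_eq_third hy
    obtain ⟨s1, s2, s3⟩ := hf s hs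
    obtain ⟨t1, t2, t3⟩ := hf t ht
    obtain ⟨hs0, hs1⟩ := hmaps hs
    obtain ⟨ht0, ht1⟩ := hmaps ht
    have hst := hM s hs t ht
    have hts := hM t ht s hs
    have hs' := hs
    have ht' := ht
    obtain ⟨hs0', hs1'⟩ := hs'
    obtain ⟨ht0', ht1'⟩ := ht'
    by_contra! hlt
    have hcases : F x - F y ≤ a * (F x - F y) ∨ F x - F y ≤ (1 - 2 * a) * (F x - F y) ∨
        F x - F y ≤ 0 := by
      rcases hxs with h | h | h <;> rcases hyt with h' | h' | h'
      · left
        nlinarith [hst (by linarith), congrArg F h, congrArg F h']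
      · right; right
        nlinarith [congrArg F h, congrArg F h']
      · right; right
        nlinarith [congrArg F h, congrArg F h']
      · have hs2 : s = 1 := by linarith
        have ht2 : t = 1 := by linarith
        right; right
        rw [h, h', hs2, ht2]
        norm_num
      · right; left
        nlinarith [hts (by linarith), congrArg F h, congrArg F h']
      · right; right
        nlinarith [congrArg F h, congrArg F h']
      · linarith
      · have hs2 : s = 0 := by linarith
        have ht2 : t = 0 := by linarith
        right; right
        rw [h, h', hs2, ht2]
        norm_num
      · left
        nlinarith [hst (by linarith), congrArg F h, congrArg F h']
    rcases hcases with h | h | h <;> nlinarith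
  intro s hs t ht hst
  linarith [hM s hs t ht hst]

/-- The graph over `[0,1]` of a function that is nondecreasing there has Hausdorff dimension at
most one. -/
theorem dimH_graphE_le_one {F : ℝ → ℝ} (hF : MonotoneOn F (Icc 0 1)) : dimH (graphE F) ≤ 1 := by
  set φ : ℝ → EuclideanSpace ℝ (Fin 2) :=
    fun x => (WithLp.equiv 2 (Fin 2 → ℝ)).symm ![x, F x] with hφ
  set h : ℝ → ℝ := fun x => x + F x with hh
  have hdist : ∀ x ∈ Icc (0 : ℝ) 1, ∀ y ∈ Icc (0 : ℝ) 1, dist (φ x) (φ y) ≤ dist (h x) (h y) := by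
    intro x hx y hy
    rw [EuclideanSpace.dist_eq, Real.dist_eq]
    apply Real.sqrt_le_iff.2 ⟨abs_nonneg _, ?_⟩
    have hprod : 0 ≤ (x - y) * (F x - F y) := by
      rcases le_total x y with hxy | hxy
      · nlinarith [hF hx hy hxy]
      · nlinarith [hF hy hx hxy]
    simp only [hφ, hh, Fin.sum_univ_two, Real.dist_eq, sq_abs, WithLp.equiv_symm_apply,
      Matrix.cons_val_zero, Matrix.cons_val_one]
    nlinarith
  have hinj : InjOn h (Icc 0 1) := by
    intro x hx y hy hxy
    have h0 : φ x = φ y := by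
      rw [← dist_le_zero, ← dist_self (h y)]
      exact (hdist x hx y hy).trans_eq (by rw [hxy])
    simpa [hφ] using congrArg (fun p : EuclideanSpace ℝ (Fin 2) => p 0) h0
  have hinv := hinj.leftInvOn_invFunOn
  have hlip : LipschitzOnWith 1 (φ ∘ Function.invFunOn h (Icc 0 1)) (h '' Icc 0 1) := by
    apply LipschitzOnWith.of_dist_le_mul
    rintro _ ⟨x, hx, rfl⟩ _ ⟨y, hy, rfl⟩
    simpa [hinv hx, hinv hy] using hdist x hx y hy
  have himage : graphE F = (φ ∘ Function.invFunOn h (Icc 0 1)) '' (h '' Icc 0 1) := by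
    rw [image_image]
    exact image_congr fun x hx => by simp [hinv hx, hφ]
  calc dimH (graphE F) ≤ dimH (h '' Icc 0 1) := himage ▸ hlip.dimH_image_le
    _ ≤ dimH (univ : Set ℝ) := dimH_mono (subset_univ _)
    _ = 1 := Real.dimH_univ

/-- The graph of any function over `[0,1]` has Hausdorff dimension at least one. -/
theorem one_le_dimH_graphE (F : ℝ → ℝ) : 1 ≤ dimH (graphE F) := by
  have himage : (EuclideanSpace.proj 0 : EuclideanSpace ℝ (Fin 2) →L[ℝ] ℝ) '' graphE F =
      Icc 0 1 := by
    rw [graphE, image_image]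
    simp
  calc (1 : ENNReal) = dimH (Icc (0 : ℝ) 1) := by
        rw [Real.dimH_of_nonempty_interior (by simp)]; simp
    _ ≤ dimH (graphE F) := by
        rw [← himage]
        exact (EuclideanSpace.proj 0 : EuclideanSpace ℝ (Fin 2) →L[ℝ] ℝ).lipschitz.dimH_image_le _

/-- For every `a ∈ (0,1/2]`, the graph of the Okamoto function with parameter `a` has
Hausdorff dimension 1. -/
theorem okamoto_graph_dimH_eq_one (a : ℝ) (ha : a ∈ Set.Ioc (0 : ℝ) (1 / 2))
    (F : ℝ → ℝ) (hF : IsOkamoto a F) :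
    dimH (graphE F) = 1 := by
  exact le_antisymm (dimH_graphE_le_one (hF.monotoneOn ha)) (one_le_dimH_graphE F)
end

section
/- Let a ∈ (0,1) and let F be an Okamoto function with parameter a. Define w₁, w₂, w₃ : ℝ² → ℝ² by w₁(x,y) = (x/3, ay), w₂(x,y) = ((2−x)/3, (2a−1)y + (1−a)), w₃(x,y) = ((2+x)/3, ay + (1−a)). Then the graph Γ_F = {(x, F(x)) : x ∈ [0,1]} satisfies Γ_F = w₁(Γ_F) ∪ w₂(Γ_F) ∪ w₃(Γ_F), and Γ_F is the unique nonempty compact subset of ℝ² with this invariance property. -/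
open Set MeasureTheory Filter

/-- The graph of `F` over `[0,1]`, as a subset of `ℝ × ℝ`. -/
def okamotoGraph (F : ℝ → ℝ) : Set (ℝ × ℝ) :=
  (fun x : ℝ => (x, F x)) '' Set.Icc 0 1

/-- A compact set covered by its images under uniform contractions is contained in every nonempty
closed set which these contractions map into itself. -/
theorem IsCompact.subset_of_subset_iUnion_image_of_contracting {X ι : Type*} [PseudoMetricSpace X]
    {c : ℝ} (hc : c < 1) {w : ι → X → X} (hw : ∀ i x y, dist (w i x) (w i y) ≤ c * dist x y)
    {K L : Set X} (hK : IsCompact K) (hKw : K ⊆ ⋃ i, w i '' K) (hL : IsClosed L)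
    (hL₀ : L.Nonempty) (hLw : ∀ i, MapsTo (w i) L L) : K ⊆ L := by
  rcases K.eq_empty_or_nonempty with rfl | hK₀
  · exact empty_subset L
  obtain ⟨p, hp, hmax⟩ :=
    hK.exists_isMaxOn hK₀ (Metric.continuous_infDist_pt L).continuousOn
  obtain ⟨i, q, hq, rfl⟩ := mem_iUnion.1 (hKw hp)
  have hqp : Metric.infDist q L ≤ Metric.infDist (w i q) L := hmax hq
  have hzero : Metric.infDist (w i q) L ≤ 0 := by
    by_contra! hpos
    have hlt : Metric.infDist q L < Metric.infDist q L + (1 - c) * Metric.infDist (w i q) L :=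
      lt_add_of_pos_right _ (mul_pos (sub_pos.2 hc) hpos)
    obtain ⟨y, hy, hqy⟩ := (Metric.infDist_lt_iff hL₀).1 hlt
    have hle : Metric.infDist (w i q) L ≤ c * dist q y :=
      (Metric.infDist_le_dist_of_mem (hLw i hy)).trans (hw i q y)
    have hdist : 0 ≤ dist q y := dist_nonneg
    rcases le_or_gt c 0 with hc₀ | hc₀
    · linarith [mul_nonpos_of_nonpos_of_nonneg hc₀ hdist]
    · nlinarith [mul_pos (sub_pos.2 hc) hpos, mul_pos (mul_pos (sub_pos.2 hc) (sub_pos.2 hc)) hpos]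
  intro x hx
  refine (hL.mem_iff_infDist_zero hL₀).2 (le_antisymm ?_ Metric.infDist_nonneg)
  exact (hmax hx).trans hzero

/-- A diagonal affine map of the plane is Lipschitz, with any constant bounding both slopes. -/
theorem dist_diagonal_affine_le {c α γ : ℝ} (hα : |α| ≤ c) (hγ : |γ| ≤ c) (β δ : ℝ)
    (p q : ℝ × ℝ) :
    dist (α * p.1 + β, γ * p.2 + δ) (α * q.1 + β, γ * q.2 + δ) ≤ c * dist p q := by
  have key : ∀ {s : ℝ}, |s| ≤ c → ∀ t u v : ℝ, dist u v ≤ dist p q →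
      dist (s * u + t) (s * v + t) ≤ c * dist p q := by
    intro s hs t u v huv
    rw [dist_add_right, Real.dist_eq, ← mul_sub, abs_mul, ← Real.dist_eq]
    exact mul_le_mul hs huv dist_nonneg ((abs_nonneg s).trans hs)
  exact max_le (key hα β _ _ (le_max_left _ _)) (key hγ δ _ _ (le_max_right _ _))

theorem IsOkamoto.isCompact_okamotoGraph {a : ℝ} {F : ℝ → ℝ} (hF : IsOkamoto a F) :
    IsCompact (okamotoGraph F) :=
  isCompact_Icc.image_of_continuousOn (continuousOn_id.prodMk hF.1)

theorem okamotoGraph_nonempty (F : ℝ → ℝ) : (okamotoGraph F).Nonempty :=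
  (nonempty_Icc.2 zero_le_one).image _

theorem IsOkamoto.okamotoGraph_eq {a : ℝ} {F : ℝ → ℝ} (hF : IsOkamoto a F)
    {w₁ w₂ w₃ : ℝ × ℝ → ℝ × ℝ}
    (hw₁ : ∀ p : ℝ × ℝ, w₁ p = (p.1 / 3, a * p.2))
    (hw₂ : ∀ p : ℝ × ℝ, w₂ p = ((2 - p.1) / 3, (2 * a - 1) * p.2 + (1 - a)))
    (hw₃ : ∀ p : ℝ × ℝ, w₃ p = ((2 + p.1) / 3, a * p.2 + (1 - a))) :
    okamotoGraph F =
      w₁ '' okamotoGraph F ∪ w₂ '' okamotoGraph F ∪ w₃ '' okamotoGraph F := by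
  have h₁ : ∀ x ∈ Icc (0 : ℝ) 1, w₁ (x, F x) = (x / 3, F (x / 3)) := fun x hx => by
    rw [hw₁, (hF.2 x hx).1]
  have h₂ : ∀ x ∈ Icc (0 : ℝ) 1, w₂ (x, F x) = ((2 - x) / 3, F ((2 - x) / 3)) := fun x hx => by
    rw [hw₂, (hF.2 x hx).2.1]
  have h₃ : ∀ x ∈ Icc (0 : ℝ) 1, w₃ (x, F x) = ((2 + x) / 3, F ((2 + x) / 3)) := fun x hx => by
    rw [hw₃, (hF.2 x hx).2.2]
  apply Subset.antisymm
  · rintro _ ⟨x, ⟨hx₀, hx₁⟩, rfl⟩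
    rcases le_total x (1 / 3) with hx | hx
    · have hm : 3 * x ∈ Icc (0 : ℝ) 1 := ⟨by linarith, by linarith⟩
      refine Or.inl (Or.inl ⟨_, mem_image_of_mem _ hm, ?_⟩)
      rw [h₁ _ hm, show 3 * x / 3 = x by ring]
    rcases le_total x (2 / 3) with hx' | hx'
    · have hm : 2 - 3 * x ∈ Icc (0 : ℝ) 1 := ⟨by linarith, by linarith⟩
      refine Or.inl (Or.inr ⟨_, mem_image_of_mem _ hm, ?_⟩)
      rw [h₂ _ hm, show (2 - (2 - 3 * x)) / 3 = x by ring]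
    · have hm : 3 * x - 2 ∈ Icc (0 : ℝ) 1 := ⟨by linarith, by linarith⟩
      refine Or.inr ⟨_, mem_image_of_mem _ hm, ?_⟩
      rw [h₃ _ hm, show (2 + (3 * x - 2)) / 3 = x by ring]
  · rintro _ ((⟨_, ⟨x, hx, rfl⟩, rfl⟩ | ⟨_, ⟨x, hx, rfl⟩, rfl⟩) | ⟨_, ⟨x, hx, rfl⟩, rfl⟩)
    · exact ⟨x / 3, ⟨by linarith [hx.1], by linarith [hx.2]⟩, (h₁ x hx).symm⟩
    · exact ⟨(2 - x) / 3, ⟨by linarith [hx.2], by linarith [hx.1]⟩, (h₂ x hx).symm⟩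
    · exact ⟨(2 + x) / 3, ⟨by linarith [hx.1], by linarith [hx.2]⟩, (h₃ x hx).symm⟩

/-- The graph of the Okamoto function with parameter `a ∈ (0,1)` is invariant under the
iterated function system `w₁, w₂, w₃`, and it is the unique nonempty compact set with
this property. -/
theorem okamoto_graph_IFS_invariant (a : ℝ) (ha : a ∈ Set.Ioo (0 : ℝ) 1)
    (F : ℝ → ℝ) (hF : IsOkamoto a F)
    (w₁ w₂ w₃ : ℝ × ℝ → ℝ × ℝ)
    (hw₁ : ∀ p : ℝ × ℝ, w₁ p = (p.1 / 3, a * p.2))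
    (hw₂ : ∀ p : ℝ × ℝ, w₂ p = ((2 - p.1) / 3, (2 * a - 1) * p.2 + (1 - a)))
    (hw₃ : ∀ p : ℝ × ℝ, w₃ p = ((2 + p.1) / 3, a * p.2 + (1 - a)))
    :
    okamotoGraph F = w₁ '' okamotoGraph F ∪ w₂ '' okamotoGraph F ∪ w₃ '' okamotoGraph F ∧
    ∀ K : Set (ℝ × ℝ), K.Nonempty → IsCompact K →
      K = w₁ '' K ∪ w₂ '' K ∪ w₃ '' K → K = okamotoGraph F := by
  have hG := hF.okamotoGraph_eq hw₁ hw₂ hw₃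
  refine ⟨hG, fun K hK₀ hK hKw => ?_⟩
  obtain ⟨ha₀, ha₁⟩ := ha
  obtain ⟨c, hc, hc₃, hca, hca'⟩ : ∃ c < (1 : ℝ), 1 / 3 ≤ c ∧ |a| ≤ c ∧ |2 * a - 1| ≤ c :=
    ⟨max (1 / 3) (max |a| |2 * a - 1|),
      max_lt (by norm_num) (max_lt (abs_lt.2 ⟨by linarith, ha₁⟩)
        (abs_lt.2 ⟨by linarith, by linarith⟩)),
      le_max_left _ _, (le_max_left _ _).trans (le_max_right _ _),
      (le_max_right _ _).trans (le_max_right _ _)⟩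
  have hpos : |(1 / 3 : ℝ)| ≤ c := by rwa [abs_of_pos (by norm_num)]
  have hneg : |(-1 / 3 : ℝ)| ≤ c := by rwa [neg_div, abs_neg, abs_of_pos (by norm_num)]
  have hw : ∀ i p q, dist (![w₁, w₂, w₃] i p) (![w₁, w₂, w₃] i q) ≤ c * dist p q := by
    intro i p q
    fin_cases i
    · convert dist_diagonal_affine_le hpos hca 0 0 p q using 3 <;> simp [hw₁] <;> ring
    · convert dist_diagonal_affine_le hneg hca' (2 / 3) (1 - a) p q using 3 <;>
        simp [hw₂] <;> ring
    · convert dist_diagonal_affine_le hpos hca (2 / 3) (1 - a) p q using 3 <;>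
        simp [hw₃] <;> ring
  have hsubset : ∀ A B : Set (ℝ × ℝ), IsCompact A → A = w₁ '' A ∪ w₂ '' A ∪ w₃ '' A →
      IsCompact B → B.Nonempty → B = w₁ '' B ∪ w₂ '' B ∪ w₃ '' B → A ⊆ B := by
    intro A B hA hAw hB hB₀ hBw
    have hunion : ∀ S : Set (ℝ × ℝ),
        ⋃ i, ![w₁, w₂, w₃] i '' S = w₁ '' S ∪ w₂ '' S ∪ w₃ '' S := fun S => by
      ext; simp [Fin.exists_fin_succ, or_assoc]
    refine hA.subset_of_subset_iUnion_image_of_contracting hc hw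
      (hAw.trans (hunion A).symm).subset hB.isClosed hB₀ fun i => mapsTo_iff_image_subset.2 ?_
    exact (subset_iUnion (fun i => ![w₁, w₂, w₃] i '' B) i).trans
      ((hunion B).trans hBw.symm).subset
  have hGc := hF.isCompact_okamotoGraph
  exact (hsubset K _ hK hKw hGc (okamotoGraph_nonempty F) hG).antisymm
    (hsubset _ K hGc hG hK hK₀ hKw)
end

section
/- Let a ∈ (1/2, 1). Define w₁, w₂, w₃ : ℝ² → ℝ² by w₁(x,y) = (x/3, ay), w₂(x,y) = ((2−x)/3, (2a−1)y + (1−a)), w₃(x,y) = ((2+x)/3, ay + (1−a)), and define E₀ = [0,1] × [0,1] and E_{i+1} = w₁(E_i) ∪ w₂(E_i) ∪ w₃(E_i) for i ≥ 0. Then the two-dimensional Lebesgue measure of E_i equals ((4a − 1)/3)^i for every i ≥ 0. -/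
open Set MeasureTheory Filter

/-- A diagonal affine map of the plane scales area by the absolute value of its determinant. -/
theorem volume_image_prod_affine (c d s t : ℝ) (S : Set (ℝ × ℝ)) :
    volume ((fun p : ℝ × ℝ => (c * p.1 + s, d * p.2 + t)) '' S) =
      ENNReal.ofReal |c * d| * volume S := by
  have himage : (fun p : ℝ × ℝ => (c * p.1 + s, d * p.2 + t)) '' S =
      (fun p => p + (s, t)) ''
        ((c • LinearMap.id : ℝ →ₗ[ℝ] ℝ).prodMap (d • LinearMap.id : ℝ →ₗ[ℝ] ℝ) '' S) := by
    rw [image_image]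
    exact image_congr fun p _ => by simp
  rw [himage, image_add_right, measure_preimage_add_right, Measure.addHaar_image_linearMap,
    LinearMap.det_prodMap]
  simp

/-- Planar sets lying on the two sides of a vertical line are disjoint up to a null set. -/
theorem aedisjoint_of_fst_le_of_le_fst {A B : Set (ℝ × ℝ)} {c : ℝ}
    (hA : ∀ p ∈ A, p.1 ≤ c) (hB : ∀ p ∈ B, c ≤ p.1) : AEDisjoint volume A B := by
  refine measure_mono_null (t := {c} ×ˢ univ) (fun p hp => ?_) ?_
  · exact ⟨le_antisymm (hA p hp.1) (hB p hp.2), mem_univ _⟩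
  · rw [Measure.volume_eq_prod, Measure.prod_prod, Real.volume_singleton, zero_mul]

/-- For `a ∈ (1/2,1)`, the two-dimensional Lebesgue measure of the `i`-th level `E i` of
the IFS construction equals `((4a − 1)/3)^i`. -/
theorem okamoto_E_volume (a : ℝ) (ha : a ∈ Set.Ioo (1 / 2 : ℝ) 1)
    (w₁ w₂ w₃ : ℝ × ℝ → ℝ × ℝ)
    (hw₁ : ∀ p : ℝ × ℝ, w₁ p = (p.1 / 3, a * p.2))
    (hw₂ : ∀ p : ℝ × ℝ, w₂ p = ((2 - p.1) / 3, (2 * a - 1) * p.2 + (1 - a)))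
    (hw₃ : ∀ p : ℝ × ℝ, w₃ p = ((2 + p.1) / 3, a * p.2 + (1 - a)))
    (E : ℕ → Set (ℝ × ℝ))
    (hE0 : E 0 = Set.Icc (0 : ℝ) 1 ×ˢ Set.Icc (0 : ℝ) 1)
    (hEsucc : ∀ i : ℕ, E (i + 1) = w₁ '' E i ∪ w₂ '' E i ∪ w₃ '' E i) :
    ∀ i : ℕ, volume (E i) = ENNReal.ofReal (((4 * a - 1) / 3) ^ i) := by
  obtain ⟨ha₁, ha₂⟩ := ha
  have e₁ : w₁ = fun p : ℝ × ℝ => (1 / 3 * p.1 + 0, a * p.2 + 0) := by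
    funext p; rw [hw₁]; congr 1 <;> ring
  have e₂ : w₂ = fun p : ℝ × ℝ => (-(1 / 3) * p.1 + 2 / 3, (2 * a - 1) * p.2 + (1 - a)) := by
    funext p; rw [hw₂]; congr 1; ring
  have e₃ : w₃ = fun p : ℝ × ℝ => (1 / 3 * p.1 + 2 / 3, a * p.2 + (1 - a)) := by
    funext p; rw [hw₃]; congr 1; ring
  have c₁ : Continuous w₁ := by rw [e₁]; fun_prop
  have c₂ : Continuous w₂ := by rw [e₂]; fun_prop
  have c₃ : Continuous w₃ := by rw [e₃]; fun_prop
  have hcompact : ∀ i, IsCompact (E i) := by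
    intro i
    induction i with
    | zero => rw [hE0]; exact isCompact_Icc.prod isCompact_Icc
    | succ i ih =>
      rw [hEsucc]
      exact ((ih.image c₁).union (ih.image c₂)).union (ih.image c₃)
  have hfst : ∀ i, ∀ p ∈ E i, p.1 ∈ Icc (0 : ℝ) 1 := by
    intro i
    induction i with
    | zero => rw [hE0]; exact fun p hp => hp.1
    | succ i ih =>
      rw [hEsucc]
      rintro _ ((⟨p, hp, rfl⟩ | ⟨p, hp, rfl⟩) | ⟨p, hp, rfl⟩) <;>
        obtain ⟨h₀, h₁⟩ := ih p hp <;> simp only [hw₁, hw₂, hw₃, mem_Icc] <;>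
        constructor <;> linarith
  intro i
  induction i with
  | zero =>
    rw [hE0, Measure.volume_eq_prod, Measure.prod_prod]
    simp
  | succ i ih =>
    have d₁₂ : AEDisjoint volume (w₁ '' E i) (w₂ '' E i) := by
      apply aedisjoint_of_fst_le_of_le_fst (c := 1 / 3) <;> rintro _ ⟨p, hp, rfl⟩ <;>
        obtain ⟨h₀, h₁⟩ := hfst i p hp <;> simp only [hw₁, hw₂] <;> linarith
    have d₃ : AEDisjoint volume (w₁ '' E i ∪ w₂ '' E i) (w₃ '' E i) := by
      apply aedisjoint_of_fst_le_of_le_fst (c := 2 / 3)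
      · rintro _ (⟨p, hp, rfl⟩ | ⟨p, hp, rfl⟩) <;>
          obtain ⟨h₀, h₁⟩ := hfst i p hp <;> simp only [hw₁, hw₂] <;> linarith
      · rintro _ ⟨p, hp, rfl⟩
        obtain ⟨h₀, h₁⟩ := hfst i p hp
        simp only [hw₃]
        linarith
    have v₁ : volume (w₁ '' E i) = ENNReal.ofReal (a / 3) * volume (E i) := by
      rw [e₁, volume_image_prod_affine, abs_of_nonneg (by linarith)]
      congr 2; ring
    have v₂ : volume (w₂ '' E i) = ENNReal.ofReal ((2 * a - 1) / 3) * volume (E i) := by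
      rw [e₂, volume_image_prod_affine, abs_of_nonpos (by linarith)]
      congr 2; ring
    have v₃ : volume (w₃ '' E i) = ENNReal.ofReal (a / 3) * volume (E i) := by
      rw [e₃, volume_image_prod_affine, abs_of_nonneg (by linarith)]
      congr 2; ring
    rw [hEsucc,
      measure_union₀ ((hcompact i).image c₃).measurableSet.nullMeasurableSet d₃,
      measure_union₀ ((hcompact i).image c₂).measurableSet.nullMeasurableSet d₁₂,
      v₁, v₂, v₃, ← add_mul, ← add_mul, ih,
      ← ENNReal.ofReal_add (by linarith) (by linarith),
      ← ENNReal.ofReal_add (by linarith) (by linarith),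
      ← ENNReal.ofReal_mul (by linarith), pow_succ']
    congr 2; ring
end

section
/- For every a ∈ (1/2, 1) and every Okamoto function F with parameter a, the one-dimensional Hausdorff measure of the graph Γ_F = {(x, F(x)) : x ∈ [0,1]} ⊆ ℝ² is infinite: H¹(Γ_F) = ∞. -/
open Set MeasureTheory Filter

/-- If `g = c * f + d` on `s`, then the variation of `g` is at least `c` times that of `f`. -/
theorem eVariationOn.ofReal_mul_le_of_eqOn {α : Type*} [LinearOrder α] {f g : α → ℝ} {s : Set α}
    {c d : ℝ} (hc : 0 ≤ c) (h : ∀ x ∈ s, g x = c * f x + d) :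
    ENNReal.ofReal c * eVariationOn f s ≤ eVariationOn g s := by
  simp only [eVariationOn, ENNReal.mul_iSup]
  refine iSup_mono fun ⟨n, u, hu, hus⟩ => ?_
  rw [Finset.mul_sum]
  refine Finset.sum_le_sum fun i _ => ?_
  rw [h _ (hus _), h _ (hus _), edist_dist, edist_dist, ← ENNReal.ofReal_mul hc, Real.dist_eq,
    Real.dist_eq, add_sub_add_right_eq_sub, ← mul_sub, abs_mul, abs_of_nonneg hc]

/-- The oscillation of a continuous function between the endpoints of an interval is at most the
length of its image, even if the left endpoint is removed. -/
theorem ContinuousOn.edist_le_volume_image_Ioc {f : ℝ → ℝ} {x y : ℝ} (hxy : x ≤ y)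
    (hf : ContinuousOn f (Icc x y)) : edist (f y) (f x) ≤ volume (f '' Ioc x y) := by
  have hsub : uIcc (f x) (f y) ⊆ f '' Ioc x y ∪ {f x} := by
    intro z hz
    obtain ⟨w, hw, rfl⟩ := intermediate_value_uIcc (by rwa [uIcc_of_le hxy]) hz
    rw [uIcc_of_le hxy] at hw
    rcases hw.1.eq_or_lt with rfl | h
    · exact Or.inr rfl
    · exact Or.inl ⟨w, ⟨h, hw.2⟩, rfl⟩
  calc edist (f y) (f x) = volume (uIcc (f x) (f y)) := by
        rw [Real.volume_interval, edist_dist, Real.dist_eq]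
    _ ≤ volume (f '' Ioc x y ∪ {f x}) := measure_mono hsub
    _ ≤ volume (f '' Ioc x y) + volume {f x} := measure_union_le _ _
    _ = volume (f '' Ioc x y) := by simp

/-- The one-dimensional Hausdorff measure of the graph of a continuous function is at least its
total variation. -/
theorem eVariationOn_le_hausdorffMeasure_graphE {F : ℝ → ℝ} (hF : ContinuousOn F (Icc 0 1)) :
    eVariationOn F (Icc 0 1) ≤ μH[1] (graphE F) := by
  refine iSup_le fun ⟨n, u, hu, hus⟩ => ?_
  let A : ℕ → Set (EuclideanSpace ℝ (Fin 2)) := fun i => {p | p 0 ∈ Ioc (u i) (u (i + 1))}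
  have hA : ∀ i, MeasurableSet (A i) := fun i =>
    (by fun_prop : Measurable fun p : EuclideanSpace ℝ (Fin 2) => p 0) measurableSet_Ioc
  have hdisj : Pairwise (Function.onFun Disjoint A) := fun i j hij =>
    (hu.pairwise_disjoint_on_Ioc_succ hij).preimage fun p : EuclideanSpace ℝ (Fin 2) => p 0
  have hproj : LipschitzWith 1 fun p : EuclideanSpace ℝ (Fin 2) => p 1 :=
    LipschitzWith.of_dist_le_mul fun p q => by
      simpa [dist_eq_norm] using PiLp.norm_apply_le (p - q) 1
  calc ∑ i ∈ Finset.range n, edist (F (u (i + 1))) (F (u i))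
      ≤ ∑ i ∈ Finset.range n, (μH[1] : Measure _).restrict (graphE F) (A i) := by
        refine Finset.sum_le_sum fun i _ => ?_
        have hsub : F '' Ioc (u i) (u (i + 1)) ⊆
            (fun p : EuclideanSpace ℝ (Fin 2) => p 1) '' (A i ∩ graphE F) := by
          rintro _ ⟨x, hx, rfl⟩
          exact ⟨_, ⟨by simpa [A] using hx, x,
            ⟨(hus i).1.trans hx.1.le, hx.2.trans (hus (i + 1)).2⟩, rfl⟩, by simp⟩
        rw [Measure.restrict_apply (hA i)]
        calc edist (F (u (i + 1))) (F (u i))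
            ≤ volume (F '' Ioc (u i) (u (i + 1))) :=
              (hF.mono (Icc_subset_Icc (hus i).1 (hus (i + 1)).2)).edist_le_volume_image_Ioc
                (hu i.le_succ)
          _ ≤ μH[1] ((fun p : EuclideanSpace ℝ (Fin 2) => p 1) '' (A i ∩ graphE F)) := by
              rw [hausdorffMeasure_real]
              exact measure_mono hsub
          _ ≤ μH[1] (A i ∩ graphE F) := by
              simpa using hproj.hausdorffMeasure_image_le zero_le_one (A i ∩ graphE F)
    _ ≤ (μH[1] : Measure _).restrict (graphE F) univ :=
        sum_measure_le_measure_univ (fun i _ => (hA i).nullMeasurableSet)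
          fun i _ j _ hij => (hdisj hij).aedisjoint
    _ = μH[1] (graphE F) := Measure.restrict_apply_univ _

/-- Okamoto functions with parameter larger than `1 / 2` have infinite total variation. -/
theorem IsOkamoto.eVariationOn_eq_top {a : ℝ} (ha : a ∈ Ioo (1 / 2 : ℝ) 1) {F : ℝ → ℝ}
    (hF : IsOkamoto a F) : eVariationOn F (Icc 0 1) = ⊤ := by
  obtain ⟨ha₀, ha₁⟩ := ha
  obtain ⟨-, hF⟩ := hF
  have hF₀ : F 0 = 0 := by
    have := (hF 0 (by simp)).1
    rw [zero_div] at this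
    nlinarith
  have hF₁ : F 1 = 1 := by
    have := (hF 1 (by simp)).2.2
    norm_num at this
    nlinarith
  set V := eVariationOn F (Icc 0 1)
  have hV₁ : 1 ≤ V := by
    simpa [hF₀, hF₁, edist_dist] using
      eVariationOn.edist_le F (s := Icc 0 1) (x := 1) (y := 0) (by simp) (by simp)
  have left : ENNReal.ofReal a * V ≤ eVariationOn F (Icc 0 (1 / 3)) :=
    (eVariationOn.ofReal_mul_le_of_eqOn (g := F ∘ fun x => x / 3) (d := 0) (by linarith)
      fun x hx => by simpa using (hF x hx).1).trans
      (eVariationOn.comp_le_of_monotoneOn F _ (fun x _ y _ h => by linarith)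
        fun x hx => ⟨by linarith [hx.1], by linarith [hx.2]⟩)
  have middle : ENNReal.ofReal (2 * a - 1) * V ≤ eVariationOn F (Icc (1 / 3) (2 / 3)) :=
    (eVariationOn.ofReal_mul_le_of_eqOn (g := F ∘ fun x => (2 - x) / 3) (by linarith)
      fun x hx => (hF x hx).2.1).trans
      (eVariationOn.comp_le_of_antitoneOn F _ (fun x _ y _ h => by linarith)
        fun x hx => ⟨by linarith [hx.2], by linarith [hx.1]⟩)
  have right : ENNReal.ofReal a * V ≤ eVariationOn F (Icc (2 / 3) 1) :=
    (eVariationOn.ofReal_mul_le_of_eqOn (g := F ∘ fun x => (2 + x) / 3) (by linarith)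
      fun x hx => (hF x hx).2.2).trans
      (eVariationOn.comp_le_of_monotoneOn F _ (fun x _ y _ h => by linarith)
        fun x hx => ⟨by linarith [hx.1], by linarith [hx.2]⟩)
  have split : eVariationOn F (Icc 0 (1 / 3)) + eVariationOn F (Icc (1 / 3) (2 / 3)) +
      eVariationOn F (Icc (2 / 3) 1) = V := by
    have h₁ := eVariationOn.Icc_add_Icc F (s := univ) (a := 0) (b := 1 / 3) (c := 2 / 3)
      (by norm_num) (by norm_num) (mem_univ _)
    have h₂ := eVariationOn.Icc_add_Icc F (s := univ) (a := 0) (b := 2 / 3) (c := 1)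
      (by norm_num) (by norm_num) (mem_univ _)
    simp only [univ_inter] at h₁ h₂
    rw [h₁, h₂]
  have expand : ENNReal.ofReal (4 * a - 1) * V ≤ V := by
    calc ENNReal.ofReal (4 * a - 1) * V
        = ENNReal.ofReal a * V + ENNReal.ofReal (2 * a - 1) * V + ENNReal.ofReal a * V := by
          rw [← add_mul, ← add_mul, ← ENNReal.ofReal_add (by linarith) (by linarith),
            ← ENNReal.ofReal_add (by linarith) (by linarith)]
          ring_nf
      _ ≤ V := (add_le_add (add_le_add left middle) right).trans_eq split
  by_contra htop
  have hV₁' : 1 ≤ V.toReal := by simpa using ENNReal.toReal_mono htop hV₁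
  have expand' := ENNReal.toReal_mono htop expand
  rw [ENNReal.toReal_mul, ENNReal.toReal_ofReal (by linarith)] at expand'
  nlinarith

/-- For every `a ∈ (1/2,1)`, the graph of the Okamoto function with parameter `a` has
infinite one-dimensional Hausdorff measure. -/
theorem okamoto_graph_H1_infinite (a : ℝ) (ha : a ∈ Set.Ioo (1 / 2 : ℝ) 1)
    (F : ℝ → ℝ) (hF : IsOkamoto a F) :
    μH[1] (graphE F) = ⊤ :=
  top_le_iff.mp <| (hF.eVariationOn_eq_top ha).ge.trans
    (eVariationOn_le_hausdorffMeasure_graphE hF.1)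
end
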